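/- Let p, q, s, k ≥ 1 be integers with p, q, s of the same odd-even parity, and let n = (p+q)/2. Then b^{(s)}_{p,q,k} = p! q! Σ_{i=0}^{⌊p/2⌋} Σ_{j=0}^{⌊q/2⌋} [ binom(n−i−j, k−1) / (2^{i+j} i! j! (n−i−j)!) ] · [ binom(k−1, (p−s)/2 − i)·binom(k−1, (q−s)/2 − j) − binom(k−1, (p+s)/2 − i)·binom(k−1, (q+s)/2 − j) ], with the convention that binom(k−1, t) = 0 for integers t < 0 or t > k−1 and binom(n−i−j, k−1) = 0 when k−1 > n−i−j. -/

import Mathlib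

/-- `binom(a, b)` for integers, with the convention that it is `0` unless `0 ≤ b ≤ a`. -/
def ichoose (a b : ℤ) : ℤ := if 0 ≤ b ∧ b ≤ a then (a.toNat).choose b.toNat else 0

/-- `psCount p q s k = b^{(s)}_{p,q,k}`: the number of paired surjections `(μ, φ)`, where
`μ` is a pairing (fixed-point-free involution) of `[p] ∪ [q]'` with exactly `s` mixed
pairs and `φ : [p] ∪ [q]' → [k]` is a surjection with `φ(μ(i)) = φ(γ_{p,q}(i))` for all
`i`, where `γ_{p,q} = (1 2 … p)(1' 2' … q')`. -/
noncomputable def psCount (p q s k : ℕ) : ℕ :=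
  Nat.card {μφ : Equiv.Perm (Fin p ⊕ Fin q) × ((Fin p ⊕ Fin q) → Fin k) //
    (∀ v, μφ.1 (μφ.1 v) = v) ∧ (∀ v, μφ.1 v ≠ v) ∧
    (Finset.univ.filter fun i : Fin p => (μφ.1 (Sum.inl i)).isRight).card = s ∧
    Function.Surjective μφ.2 ∧
    ∀ v, μφ.2 (μφ.1 v) = μφ.2 (Equiv.sumCongr (finRotate p) (finRotate q) v)}

namespace PS
set_option linter.unusedSectionVars false
set_option linter.unusedSimpArgs false
open MvPolynomial

section Gen
variable {ι : Type} [Fintype ι] [DecidableEq ι]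

lemma pderiv_comm' (i j : ι) (f : MvPolynomial ι ℚ) :
    pderiv i (pderiv j f) = pderiv j (pderiv i f) := by
  induction f using MvPolynomial.induction_on with
  | C a => simp
  | add p q hp hq => simp [hp, hq]
  | mul_X p k hp =>
    have h1 : ∀ a b : ι, pderiv a (Pi.single (M := fun _ => MvPolynomial ι ℚ) b 1 k) = 0 := by
      intro a b
      by_cases h : b = k
      · subst h; simp
      · simp [Pi.single_apply, Ne.symm h]
    simp only [pderiv_mul, map_add, pderiv_X, hp, h1]
    ring

/-- Laplacian -/
noncomputable def lap (st : ι → ι) : MvPolynomial ι ℚ →ₗ[ℚ] MvPolynomial ι ℚ :=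
  ∑ i, (pderiv (R := ℚ) i).toLinearMap ∘ₗ (pderiv (st i)).toLinearMap

lemma lap_apply (st : ι → ι) (f : MvPolynomial ι ℚ) :
    lap st f = ∑ i, pderiv i (pderiv (st i) f) := by
  simp [lap, LinearMap.sum_apply]

lemma pderiv_lap (st : ι → ι) (j : ι) (f : MvPolynomial ι ℚ) :
    pderiv j (lap st f) = lap st (pderiv j f) := by
  simp only [lap_apply, map_sum]
  refine Finset.sum_congr rfl fun i _ => ?_
  rw [pderiv_comm' j i, pderiv_comm' j (st i)]

lemma lap_mul (st : ι → ι) (hst : ∀ i, st (st i) = i) (f g : MvPolynomial ι ℚ) :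
    lap st (f * g) = lap st f * g + 2 * ∑ i, pderiv i f * pderiv (st i) g + f * lap st g := by
  have h : ∑ i, pderiv (st i) f * pderiv i g = ∑ i, pderiv i f * pderiv (st i) g := by
    refine Finset.sum_nbij' st st (by simp) (by simp) (by simp [hst]) (by simp [hst]) ?_
    intro i _; rw [hst]
  rw [two_mul]
  nth_rewrite 1 [← h]
  simp only [lap_apply, pderiv_mul, map_add, Finset.sum_mul, Finset.mul_sum,
    ← Finset.sum_add_distrib]
  refine Finset.sum_congr rfl fun i _ => ?_
  ring

lemma lap_X_mul (st : ι → ι) (hst : ∀ i, st (st i) = i) (i : ι) (f : MvPolynomial ι ℚ) :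
    lap st (X i * f) = X i * lap st f + 2 * pderiv (st i) f := by
  rw [lap_mul st hst]
  have h0 : lap st (X i : MvPolynomial ι ℚ) = 0 := by
    rw [lap_apply]
    refine Finset.sum_eq_zero fun k _ => ?_
    rw [pderiv_X]
    by_cases h : st k = i
    · subst h; simp
    · simp [Pi.single_apply, Ne.symm h]
  rw [h0, Finset.sum_eq_single i]
  · simp; ring
  · intro b _ hb; simp [pderiv_X_of_ne (Ne.symm hb)]
  · simp

lemma lap_C (st : ι → ι) (a : ℚ) : lap st (C a) = 0 := by simp [lap_apply]

lemma lapn_X_mul (st : ι → ι) (hst : ∀ i, st (st i) = i) (i : ι) (n : ℕ)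
    (f : MvPolynomial ι ℚ) :
    (lap st ^ (n+1)) (X i * f) = X i * (lap st ^ (n+1)) f
      + (2 * (n+1) : ℚ) • pderiv (st i) ((lap st ^ n) f) := by
  have hc : ∀ n (g : MvPolynomial ι ℚ), pderiv (st i) ((lap st ^ n) g)
      = (lap st ^ n) (pderiv (st i) g) := by
    intro n; induction n with
    | zero => simp
    | succ n ih => intro g; rw [pow_succ, Module.End.mul_apply, Module.End.mul_apply, ih, pderiv_lap]
  have h2 : ∀ n (g : MvPolynomial ι ℚ), (lap st ^ (n+1)) g = (lap st ^ n) (lap st g) := by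
    intro n g; rw [pow_succ, Module.End.mul_apply]
  have h3 : ∀ g : MvPolynomial ι ℚ, 2 * g = (2:ℚ) • g := by
    intro g; rw [two_smul, two_mul]
  induction n generalizing f with
  | zero =>
    simp [lap_X_mul st hst, h3]
  | succ n ih =>
    rw [h2 (n+1), lap_X_mul st hst, map_add, ih, h2 (n+1), h3, map_smul, ← hc, ← h2 n,
      add_assoc, ← add_smul]
    congr 2
    push_cast; ring

lemma lap_nil (st : ι → ι) (hst : ∀ i, st (st i) = i) (f : MvPolynomial ι ℚ) :
    ∃ K, ∀ n, K ≤ n → (lap st ^ n) f = 0 := by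
  induction f using MvPolynomial.induction_on with
  | C a =>
    refine ⟨1, fun n hn => ?_⟩
    obtain ⟨m, rfl⟩ := Nat.exists_eq_add_of_le' hn
    rw [pow_succ, Module.End.mul_apply, lap_C, map_zero]
  | add p q hp hq =>
    obtain ⟨K, hK⟩ := hp
    obtain ⟨K', hK'⟩ := hq
    refine ⟨max K K', fun n hn => ?_⟩
    rw [map_add, hK n (le_trans (le_max_left _ _) hn), hK' n (le_trans (le_max_right _ _) hn), add_zero]
  | mul_X p k hp =>
    obtain ⟨K, hK⟩ := hp
    refine ⟨K+1, fun n hn => ?_⟩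
    obtain ⟨m, rfl⟩ := Nat.exists_eq_add_of_le' (le_trans (Nat.le_add_left 1 K) hn)
    rw [mul_comm, lapn_X_mul st hst, hK _ (by omega), hK _ (by omega)]
    simp

/-- exp of c times the Laplacian -/
noncomputable def U (st : ι → ι) (c : ℚ) (f : MvPolynomial ι ℚ) : MvPolynomial ι ℚ :=
  ∑ᶠ n : ℕ, (c ^ n / n.factorial : ℚ) • (lap st ^ n) f

lemma U_eq (st : ι → ι) (c : ℚ) (f : MvPolynomial ι ℚ) (K : ℕ)
    (hK : ∀ n, K ≤ n → (lap st ^ n) f = 0) :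
    U st c f = ∑ n ∈ Finset.range K, (c ^ n / n.factorial : ℚ) • (lap st ^ n) f := by
  unfold U
  refine finsum_eq_sum_of_support_subset _ ?_
  intro n hn
  simp only [Finset.coe_range, Set.mem_Iio]
  by_contra h
  exact hn (by simp only [hK n (by omega), smul_zero])

lemma U_add (st : ι → ι) (hst : ∀ i, st (st i) = i) (c : ℚ) (f g : MvPolynomial ι ℚ) :
    U st c (f + g) = U st c f + U st c g := by
  obtain ⟨K, hK⟩ := lap_nil st hst f
  obtain ⟨K', hK'⟩ := lap_nil st hst g
  rw [U_eq st c f (max K K') fun n hn => hK n (le_trans (le_max_left _ _) hn),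
    U_eq st c g (max K K') fun n hn => hK' n (le_trans (le_max_right _ _) hn),
    U_eq st c (f+g) (max K K'), ← Finset.sum_add_distrib]
  · simp
  · intro n hn
    rw [map_add, hK n (le_trans (le_max_left _ _) hn), hK' n (le_trans (le_max_right _ _) hn), add_zero]

lemma U_smul (st : ι → ι) (hst : ∀ i, st (st i) = i) (c a : ℚ) (f : MvPolynomial ι ℚ) :
    U st c (a • f) = a • U st c f := by
  obtain ⟨K, hK⟩ := lap_nil st hst f
  rw [U_eq st c f K hK, U_eq st c (a • f) K, Finset.smul_sum]
  · refine Finset.sum_congr rfl fun n _ => ?_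
    rw [map_smul, smul_comm]
  · intro n hn; rw [map_smul, hK n hn, smul_zero]

/-- U as a linear map -/
noncomputable def UL (st : ι → ι) (hst : ∀ i, st (st i) = i) (c : ℚ) :
    MvPolynomial ι ℚ →ₗ[ℚ] MvPolynomial ι ℚ where
  toFun := U st c
  map_add' := U_add st hst c
  map_smul' := fun a f => U_smul st hst c a f

lemma UL_fix (st : ι → ι) (hst : ∀ i, st (st i) = i) (c : ℚ) (f : MvPolynomial ι ℚ)
    (hf : lap st f = 0) : UL st hst c f = f := by
  change U st c f = f
  rw [U_eq st c f 1]
  · simp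
  · intro n hn
    obtain ⟨m, rfl⟩ := Nat.exists_eq_add_of_le' hn
    rw [pow_succ, Module.End.mul_apply, hf, map_zero]

lemma UL_X_mul (st : ι → ι) (hst : ∀ i, st (st i) = i) (c : ℚ) (i : ι) (f : MvPolynomial ι ℚ) :
    UL st hst c (X i * f) = X i * UL st hst c f + (2 * c) • pderiv (st i) (UL st hst c f) := by
  change U st c _ = X i * U st c f + (2 * c) • pderiv (st i) (U st c f)
  obtain ⟨K, hK⟩ := lap_nil st hst f
  have hK2 : ∀ n, K + 1 ≤ n → (lap st ^ n) (X i * f) = 0 := by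
    intro n hn
    obtain ⟨m, rfl⟩ := Nat.exists_eq_add_of_le' (le_trans (Nat.le_add_left 1 K) hn)
    rw [lapn_X_mul st hst, hK _ (by omega), hK _ (by omega)]
    simp
  rw [U_eq st c _ (K+1) hK2]
  nth_rewrite 1 [U_eq st c f (K+1) fun n hn => hK n (by omega)]
  rw [U_eq st c f K hK, Finset.sum_range_succ', Finset.sum_range_succ']
  simp only [lapn_X_mul st hst, mul_add, Finset.mul_sum, map_sum, Finset.smul_sum, smul_add,
    Finset.sum_add_distrib, Derivation.map_smul]
  simp only [pow_zero, Nat.factorial_zero, Module.End.one_apply]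
  rw [add_right_comm]
  congr 1
  · congr 1
    · refine Finset.sum_congr rfl fun n _ => ?_
      rw [mul_smul_comm]
    · simp
  · refine Finset.sum_congr rfl fun n _ => ?_
    rw [smul_smul, smul_smul]
    congr 1
    rw [Nat.factorial_succ]
    push_cast
    have : (n.factorial : ℚ) ≠ 0 := by positivity
    field_simp
    ring

lemma pderiv_UL (st : ι → ι) (hst : ∀ i, st (st i) = i) (c : ℚ) (i : ι) (f : MvPolynomial ι ℚ) :
    pderiv i (UL st hst c f) = UL st hst c (pderiv i f) := by
  change pderiv i (U st c f) = U st c _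
  have hc : ∀ n (g : MvPolynomial ι ℚ), pderiv i ((lap st ^ n) g)
      = (lap st ^ n) (pderiv i g) := by
    intro n; induction n with
    | zero => simp
    | succ n ih => intro g; rw [pow_succ, Module.End.mul_apply, Module.End.mul_apply, ih, pderiv_lap]
  obtain ⟨K, hK⟩ := lap_nil st hst f
  rw [U_eq st c f K hK, U_eq st c _ K]
  · simp [hc]
  · intro n hn; rw [← hc, hK n hn, map_zero]

lemma UL_inv (st : ι → ι) (hst : ∀ i, st (st i) = i) (c : ℚ) (f : MvPolynomial ι ℚ) :
    UL st hst c (UL st hst (-c) f) = f := by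
  induction f using MvPolynomial.induction_on with
  | C a => rw [UL_fix _ _ _ _ (lap_C st a), UL_fix _ _ _ _ (lap_C st a)]
  | add p q hp hq => rw [map_add, map_add, hp, hq]
  | mul_X p k hp =>
    rw [mul_comm, UL_X_mul, map_add, UL_X_mul, hp, map_smul, ← pderiv_UL, hp, add_assoc, ← add_smul]
    simp

lemma UL_mem (st : ι → ι) (hst : ∀ i, st (st i) = i) (c : ℚ) (f : MvPolynomial ι ℚ) :
    ∃ K, ∀ K', K ≤ K' → UL st hst c f
      = ∑ n ∈ Finset.range K', (c ^ n / n.factorial : ℚ) • (lap st ^ n) f := by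
  obtain ⟨K, hK⟩ := lap_nil st hst f
  exact ⟨K, fun K' h => U_eq st c f K' fun n hn => hK n (by omega)⟩

lemma pderiv_hom (j : ι) (s : ℕ) (f : MvPolynomial ι ℚ) :
    pderiv j (homogeneousComponent (s+1) f) = homogeneousComponent s (pderiv j f) := by
  ext m
  simp only [coeff_pderiv, coeff_homogeneousComponent]
  have : (m + Finsupp.single j 1).degree = m.degree + 1 := by simp
  rw [this]
  by_cases h : m.degree = s <;> simp [h]

lemma pderiv_hom_zero (j : ι) (f : MvPolynomial ι ℚ) :
    pderiv j (homogeneousComponent 0 f) = 0 := by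
  rw [homogeneousComponent_zero]; simp

end Gen
end PS

namespace PS
set_option linter.unusedSectionVars false
set_option linter.unusedSimpArgs false
open MvPolynomial

section Wick
variable {ι : Type} [Fintype ι] [DecidableEq ι] {E : Type} [Fintype E] [DecidableEq E]

open Classical in
noncomputable def PSet (st : ι → ι) (c : E → ι) (L : E → Bool) (S : Finset E) (s : ℕ) :
    Finset (Equiv.Perm E) :=
  Finset.univ.filter fun μ => (∀ v, μ (μ v) = v) ∧ (∀ v, v ∈ S ↔ μ v ≠ v) ∧
    (∀ v ∈ S, c (μ v) = st (c v)) ∧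
    (Finset.univ.filter fun v => L v = true ∧ L (μ v) = false).card = s

lemma mem_PSet (st : ι → ι) (c : E → ι) (L : E → Bool) (S : Finset E) (s : ℕ) (μ : Equiv.Perm E) :
    μ ∈ PSet st c L S s ↔ (∀ v, μ (μ v) = v) ∧ (∀ v, v ∈ S ↔ μ v ≠ v) ∧
    (∀ v ∈ S, c (μ v) = st (c v)) ∧
    (Finset.univ.filter fun v => L v = true ∧ L (μ v) = false).card = s := by
  simp [PSet]

lemma PSet_swap (st : ι → ι) (hst : ∀ i, st (st i) = i) (c : E → ι) (L : E → Bool)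
    (S : Finset E) (s : ℕ) (a b : E) (ha : a ∈ S) (hb : b ∈ S) (hab : b ≠ a)
    (hL : L a = true) (hc : c b = st (c a)) (ν : Equiv.Perm E) (hνa : ν a = a) (hνb : ν b = b) :
    Equiv.swap a b * ν ∈ PSet st c L S (s + if L b then 0 else 1) ↔
      ν ∈ PSet st c L ((S.erase a).erase b) s := by
  set μ := Equiv.swap a b * ν with hμ
  have hμa : μ a = b := by simp [hμ, hνa]
  have hμb : μ b = a := by simp [hμ, hνb]
  have ho : ∀ v, v ≠ a → v ≠ b → ν v ≠ a ∧ ν v ≠ b := by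
    intro v h1 h2
    exact ⟨fun h => h1 (ν.injective (h.trans hνa.symm)), fun h => h2 (ν.injective (h.trans hνb.symm))⟩
  have hμo : ∀ v, v ≠ a → v ≠ b → μ v = ν v := by
    intro v h1 h2
    obtain ⟨h3, h4⟩ := ho v h1 h2
    simp [hμ, Equiv.swap_apply_of_ne_of_ne h3 h4]
  have hmix : (Finset.univ.filter fun v => L v = true ∧ L (μ v) = false).card
      = (Finset.univ.filter fun v => L v = true ∧ L (ν v) = false).card + if L b then 0 else 1 := by
    by_cases hLb : L b = true
    · simp only [hLb, if_true, add_zero]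
      congr 1
      ext v
      simp only [Finset.mem_filter, Finset.mem_univ, true_and]
      by_cases h1 : v = a
      · subst h1; simp [hμa, hνa, hL, hLb]
      · by_cases h2 : v = b
        · subst h2; simp [hμb, hνb, hL, hLb]
        · rw [hμo v h1 h2]
    · have hLb' : L b = false := by simpa using hLb
      have : (Finset.univ.filter fun v => L v = true ∧ L (μ v) = false)
        = insert a (Finset.univ.filter fun v => L v = true ∧ L (ν v) = false) := by
        ext v
        simp only [Finset.mem_filter, Finset.mem_univ, true_and, Finset.mem_insert]
        by_cases h1 : v = a
        · subst h1; simp [hμa, hνa, hL, hLb']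
        · by_cases h2 : v = b
          · subst h2; simp [hμb, hνb, hL, hLb', h1]
          · rw [hμo v h1 h2]; simp [h1]
      rw [this, Finset.card_insert_of_notMem (by simp [hνa, hL]), if_neg hLb]
  rw [mem_PSet, mem_PSet, hmix, add_left_inj]
  refine and_congr ?_ (and_congr ?_ (and_congr_left' ?_))
  · refine forall_congr' fun v => ?_
    by_cases h1 : v = a
    · subst h1; simp [hμa, hμb, hνa]
    · by_cases h2 : v = b
      · subst h2; simp [hμa, hμb, hνb]
      · rw [hμo v h1 h2, hμo _ (ho v h1 h2).1 (ho v h1 h2).2]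
  · refine forall_congr' fun v => ?_
    by_cases h1 : v = a
    · subst h1; simp [hμa, hνa, ha, hab]
    · by_cases h2 : v = b
      · subst h2; simp [hμb, hνb, hb, Ne.symm hab]
      · rw [hμo v h1 h2]; simp [h1, h2]
  · refine forall_congr' fun v => ?_
    by_cases h1 : v = a
    · subst h1; simp [hμa, ha, hc]
    · by_cases h2 : v = b
      · subst h2; simp [hμb, hb, hc, hst]
      · rw [hμo v h1 h2]; simp [h1, h2]

lemma card_fiber (st : ι → ι) (hst : ∀ i, st (st i) = i) (c : E → ι) (L : E → Bool)
    (S : Finset E) (s : ℕ) (a b : E) (ha : a ∈ S) (hb : b ∈ S) (hab : b ≠ a)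
    (hL : L a = true) (hc : c b = st (c a)) :
    ((PSet st c L S (s + if L b then 0 else 1)).filter fun μ => μ a = b).card =
      (PSet st c L ((S.erase a).erase b) s).card := by
  refine Finset.card_nbij' (fun μ => Equiv.swap a b * μ) (fun ν => Equiv.swap a b * ν) ?_ ?_ ?_ ?_
  · intro μ hμ
    simp only [Finset.coe_filter, Set.mem_ofPred_eq] at hμ
    obtain ⟨hμ, h⟩ := hμ
    have h' : μ b = a := by rw [← h]; exact ((mem_PSet _ _ _ _ _ _).1 hμ).1 a
    have := (PSet_swap st hst c L S s a b ha hb hab hL hc (Equiv.swap a b * μ) (by simp [h])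
      (by simp [h'])).1 (by rw [← mul_assoc]; simpa using hμ)
    simpa using this
  · intro ν hν
    have hν' : ν ∈ PSet st c L ((S.erase a).erase b) s := by simpa using hν
    have h2 := ((mem_PSet _ _ _ _ _ _).1 hν').2.1
    have hνa : ν a = a := by
      have := h2 a; simp at this; exact this
    have hνb : ν b = b := by
      have := h2 b; simp at this; exact this
    have := (PSet_swap st hst c L S s a b ha hb hab hL hc ν hνa hνb).2 hν'
    simp only [Finset.coe_filter, Set.mem_ofPred_eq]
    exact ⟨this, by simp [hνa]⟩
  · intro μ _; simp [← mul_assoc]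
  · intro μ _; simp [← mul_assoc]

lemma card_fiber0 (st : ι → ι) (c : E → ι) (L : E → Bool)
    (S : Finset E) (a b : E) (hL : L a = true) (hLb : L b = false) :
    ((PSet st c L S 0).filter fun μ => μ a = b).card = 0 := by
  rw [Finset.card_eq_zero, Finset.filter_eq_empty_iff]
  intro μ hμ h
  have := ((mem_PSet _ _ _ _ _ _).1 hμ).2.2.2
  rw [Finset.card_eq_zero, Finset.filter_eq_empty_iff] at this
  exact this (Finset.mem_univ a) ⟨hL, by rw [h]; exact hLb⟩

lemma card_fiber_ne (st : ι → ι) (c : E → ι) (L : E → Bool)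
    (S : Finset E) (s : ℕ) (a b : E) (ha : a ∈ S) (hc : c b ≠ st (c a)) :
    ((PSet st c L S s).filter fun μ => μ a = b).card = 0 := by
  rw [Finset.card_eq_zero, Finset.filter_eq_empty_iff]
  intro μ hμ h
  have := ((mem_PSet _ _ _ _ _ _).1 hμ).2.2.1 a ha
  rw [h] at this
  exact hc this

lemma card_PSet_rec (st : ι → ι) (c : E → ι) (L : E → Bool)
    (S : Finset E) (s : ℕ) (a : E) (ha : a ∈ S) :
    (PSet st c L S s).card = ∑ b ∈ S.erase a, ((PSet st c L S s).filter fun μ => μ a = b).card := by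
  refine Finset.card_eq_sum_card_fiberwise ?_
  intro μ hμ
  have h := (mem_PSet _ _ _ _ _ _).1 (by simpa using hμ)
  simp only [Finset.coe_erase, Set.mem_sdiff, Finset.mem_coe, Set.mem_singleton_iff]
  refine ⟨(h.2.1 _).2 ?_, (h.2.1 a).1 ha⟩
  rw [h.1]; exact Ne.symm ((h.2.1 a).1 ha)

lemma PSet_right (st : ι → ι) (c : E → ι) (L : E → Bool) (S : Finset E) (s : ℕ)
    (hS : ∀ v ∈ S, L v = false) :
    PSet st c L S s = if s = 0 then PSet st c (fun _ => true) S 0 else ∅ := by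
  have key : ∀ μ : Equiv.Perm E, (∀ v, v ∈ S ↔ μ v ≠ v) →
      (Finset.univ.filter fun v => L v = true ∧ L (μ v) = false).card = 0 := by
    intro μ hμ
    rw [Finset.card_eq_zero, Finset.filter_eq_empty_iff]
    rintro v - ⟨h1, h2⟩
    by_cases hv : v ∈ S
    · simp [hS v hv] at h1
    · have : μ v = v := by by_contra h; exact hv ((hμ v).2 h)
      rw [this, h1] at h2; simp at h2
  split_ifs with h
  · subst h
    ext μ
    rw [mem_PSet, mem_PSet]
    refine and_congr_right fun _ => and_congr_right fun h => and_congr_right fun _ => ?_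
    rw [key μ h]; simp
  · rw [Finset.eq_empty_iff_forall_notMem]
    intro μ hμ
    rw [mem_PSet] at hμ
    rw [key μ hμ.2.1] at hμ
    exact h hμ.2.2.2.symm

lemma pderiv_prod' {ι E : Type} [DecidableEq E] (f : E → MvPolynomial ι ℚ) (T : Finset E) (j : ι) :
    pderiv j (∏ v ∈ T, f v) = ∑ b ∈ T, (∏ v ∈ T.erase b, f v) * pderiv j (f b) := by
  induction T using Finset.induction_on with
  | empty => simp
  | insert a T ha ih =>
    rw [Finset.prod_insert ha, pderiv_mul, ih, Finset.sum_insert ha, Finset.erase_insert ha,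
      Finset.mul_sum]
    congr 1
    · ring
    · refine Finset.sum_congr rfl fun b hb => ?_
      have hne : a ≠ b := by rintro rfl; exact ha hb
      rw [Finset.erase_insert_of_ne hne, Finset.prod_insert (by simp [ha])]
      ring

lemma pderiv_prodX (c : E → ι) (T : Finset E) (j : ι) :
    pderiv j (∏ v ∈ T, X (c v) : MvPolynomial ι ℚ)
      = ∑ b ∈ T, if c b = j then ∏ v ∈ T.erase b, X (c v) else 0 := by
  rw [pderiv_prod']
  refine Finset.sum_congr rfl fun b hb => ?_
  by_cases h : c b = j
  · subst h; simp
  · simp [h, pderiv_X_of_ne h]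

/-- Wick functional -/
noncomputable def QQ (st : ι → ι) (hst : ∀ i, st (st i) = i) (s : ℕ) (f g : MvPolynomial ι ℚ) : ℚ :=
  constantCoeff (UL st hst (1/2) (f * UL st hst (-(1/2))
    (homogeneousComponent s (UL st hst (1/2) g))))

lemma QQ_X (st : ι → ι) (hst : ∀ i, st (st i) = i) (s : ℕ) (f g : MvPolynomial ι ℚ) (i : ι) :
    QQ st hst s (X i * f) g = QQ st hst s (pderiv (st i) f) g +
      if s = 0 then 0 else QQ st hst (s-1) f (pderiv (st i) g) := by
  unfold QQ
  rw [mul_assoc, UL_X_mul, pderiv_UL, pderiv_mul, pderiv_UL, map_add, map_mul, constantCoeff_X,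
    zero_mul, zero_add, map_add]
  have : (2 * (1/2) : ℚ) = 1 := by norm_num
  rw [this, one_smul, map_add]
  congr 1
  rcases s with _ | s
  · simp [pderiv_hom_zero]
  · simp [pderiv_hom, pderiv_UL]

lemma QQ_sum_left (st : ι → ι) (hst : ∀ i, st (st i) = i) (s : ℕ) {α : Type*} (T : Finset α)
    (f : α → MvPolynomial ι ℚ) (g : MvPolynomial ι ℚ) :
    QQ st hst s (∑ a ∈ T, f a) g = ∑ a ∈ T, QQ st hst s (f a) g := by
  simp [QQ, Finset.sum_mul]

lemma QQ_sum_right (st : ι → ι) (hst : ∀ i, st (st i) = i) (s : ℕ) {α : Type*} (T : Finset α)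
    (g : α → MvPolynomial ι ℚ) (f : MvPolynomial ι ℚ) :
    QQ st hst s f (∑ a ∈ T, g a) = ∑ a ∈ T, QQ st hst s f (g a) := by
  simp [QQ, Finset.mul_sum]

lemma QQ_zero_left (st : ι → ι) (hst : ∀ i, st (st i) = i) (s : ℕ) (g : MvPolynomial ι ℚ) :
    QQ st hst s 0 g = 0 := by simp [QQ]
lemma QQ_zero_right (st : ι → ι) (hst : ∀ i, st (st i) = i) (s : ℕ) (g : MvPolynomial ι ℚ) :
    QQ st hst s g 0 = 0 := by simp [QQ]

lemma UL_one (st : ι → ι) (hst : ∀ i, st (st i) = i) (c : ℚ) : UL st hst c 1 = 1 :=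
  UL_fix _ _ _ _ (by simpa using lap_C st 1)

lemma QQ_one_left (st : ι → ι) (hst : ∀ i, st (st i) = i) (s : ℕ) (g : MvPolynomial ι ℚ) :
    QQ st hst s 1 g = if s = 0 then QQ st hst 0 g 1 else 0 := by
  unfold QQ
  rw [one_mul, UL_inv]
  split_ifs with h
  · subst h
    rw [UL_one, homogeneousComponent_zero, homogeneousComponent_zero]
    simp [UL_one]
    rfl
  · rw [constantCoeff_eq, coeff_homogeneousComponent, if_neg]
    simpa using Ne.symm h

theorem wick (st : ι → ι) (hst : ∀ i, st (st i) = i) (c : E → ι) (n : ℕ) :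
    ∀ (L : E → Bool) (S : Finset E) (s : ℕ), S.card = n →
    ((PSet st c L S s).card : ℚ) = QQ st hst s (∏ v ∈ S.filter (fun v => L v = true), X (c v))
      (∏ v ∈ S.filter (fun v => L v = false), X (c v)) := by
  induction n using Nat.strong_induction_on with
  | _ n ih =>
  -- case with a left element
  have main : ∀ (L : E → Bool) (S : Finset E) (s : ℕ), S.card = n → (∃ a ∈ S, L a = true) →
    ((PSet st c L S s).card : ℚ) = QQ st hst s (∏ v ∈ S.filter (fun v => L v = true), X (c v))
      (∏ v ∈ S.filter (fun v => L v = false), X (c v)) := by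
    rintro L S s hS ⟨a, ha, hL⟩
    have haf : a ∈ S.filter (fun v => L v = true) := by simp [ha, hL]
    rw [← Finset.mul_prod_erase _ _ haf, QQ_X, pderiv_prodX, pderiv_prodX, QQ_sum_left,
      QQ_sum_right, card_PSet_rec st c L S s a ha]
    have hsplit : S.erase a = ((S.filter (fun v => L v = true)).erase a) ∪
        (S.filter (fun v => L v = false)) := by
      ext v
      simp only [Finset.mem_erase, Finset.mem_union, Finset.mem_filter]
      by_cases h : v = a
      · subst h; simp [hL]
      · cases L v <;> simp [h]
    have hdis : Disjoint ((S.filter (fun v => L v = true)).erase a)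
        (S.filter (fun v => L v = false)) := by
      rw [Finset.disjoint_left]
      intro v h1 h2
      simp only [Finset.mem_erase, Finset.mem_filter] at h1 h2
      rw [h1.2.2] at h2; simp at h2
    rw [hsplit, Finset.sum_union hdis, Nat.cast_add, Nat.cast_sum, Nat.cast_sum]
    congr 1
    · refine Finset.sum_congr rfl fun b hb => ?_
      simp only [Finset.mem_erase, Finset.mem_filter] at hb
      by_cases hc : c b = st (c a)
      · rw [if_pos hc]
        have h1 := card_fiber st hst c L S s a b ha hb.2.1 hb.1 hL hc
        simp only [hb.2.2, if_true, add_zero] at h1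
        rw [h1, ih _ _ L _ s rfl]
        · congr 2
          · ext v; simp only [Finset.mem_erase, Finset.mem_filter]; tauto
          · ext v; simp only [Finset.mem_erase, Finset.mem_filter]
            constructor
            · tauto
            · rintro ⟨h3, h4⟩
              refine ⟨⟨?_, ?_, h3⟩, h4⟩
              · rintro rfl; simp [hb.2.2] at h4
              · rintro rfl; simp [hL] at h4
        · rw [Finset.card_erase_of_mem (by simp [hb.1, hb.2.1]), Finset.card_erase_of_mem ha]
          have := Finset.card_pos.2 ⟨a, ha⟩
          omega
      · rw [if_neg hc, card_fiber_ne st c L S s a b ha hc, QQ_zero_left]; simp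
    · rcases s with _ | s
      · rw [if_pos rfl]
        refine Finset.sum_eq_zero fun b hb => ?_
        simp only [Finset.mem_filter] at hb
        rw [card_fiber0 st c L S a b hL hb.2]; simp
      · rw [if_neg (by omega)]
        refine Finset.sum_congr rfl fun b hb => ?_
        simp only [Finset.mem_filter] at hb
        have hba : b ≠ a := by rintro rfl; simp [hL] at hb
        by_cases hc : c b = st (c a)
        · rw [if_pos hc]
          have h1 := card_fiber st hst c L S s a b ha hb.1 hba hL hc
          simp only [hb.2] at h1
          simp only [Bool.false_eq_true, if_false] at h1
          rw [h1, ih _ _ L _ s rfl]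
          · congr 2
            · ext v; simp only [Finset.mem_erase, Finset.mem_filter]
              constructor
              · tauto
              · rintro ⟨h2, h3, h4⟩
                refine ⟨⟨?_, h2, h3⟩, h4⟩
                rintro rfl; simp [hb.2] at h4
            · ext v; simp only [Finset.mem_erase, Finset.mem_filter]
              constructor
              · tauto
              · rintro ⟨h2, h3, h4⟩
                refine ⟨⟨h2, ?_, h3⟩, h4⟩
                rintro rfl; simp [hL] at h4
          · rw [Finset.card_erase_of_mem (by simp [hba, hb.1]), Finset.card_erase_of_mem ha]
            have := Finset.card_pos.2 ⟨a, ha⟩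
            omega
        · rw [if_neg hc, card_fiber_ne st c L S _ a b ha hc, QQ_zero_right]; simp
  intro L S s hS
  by_cases hex : ∃ a ∈ S, L a = true
  · exact main L S s hS hex
  · have hR : ∀ v ∈ S, L v = false := by
      intro v hv
      by_contra h
      exact hex ⟨v, hv, by simpa using h⟩
    have e1 : S.filter (fun v => L v = true) = ∅ := by
      rw [Finset.filter_eq_empty_iff]; intro v hv; simp [hR v hv]
    have e2 : S.filter (fun v => L v = false) = S := Finset.filter_true_of_mem hR
    rw [e1, e2, Finset.prod_empty, QQ_one_left, PSet_right st c L S s hR]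
    split_ifs with h
    · rcases S.eq_empty_or_nonempty with h0 | ⟨a, ha⟩
      · subst h0
        simp [QQ, UL_one, homogeneousComponent_zero]
        have : PSet st c (fun _ => true) ∅ 0 = {1} := by
          ext μ
          rw [mem_PSet, Finset.mem_singleton]
          constructor
          · rintro ⟨-, h, -⟩
            ext v
            by_contra h'
            exact absurd ((h v).2 h') (by simp)
          · rintro rfl; simp
        rw [this]; simp
      · have := main (fun _ => true) S 0 hS ⟨a, ha, rfl⟩
        rw [this]
        simp
    · simp

end Wick
end PS

namespace PS
set_option linter.unusedSectionVars false
set_option linter.unusedSimpArgs false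
open MvPolynomial

section XSide
variable {N : ℕ}

noncomputable def pw (N m : ℕ) : MvPolynomial (Fin N) ℚ := ∑ i, X i ^ m

noncomputable def mon (e : Fin N → ℕ) : MvPolynomial (Fin N) ℚ := ∏ k, X k ^ e k

noncomputable def alt (α : Fin N → ℕ) : MvPolynomial (Fin N) ℚ :=
  (Matrix.of fun j i => X i ^ α j : Matrix (Fin N) (Fin N) (MvPolynomial (Fin N) ℚ)).det

lemma alt_eq (α : Fin N → ℕ) :
    alt α = ∑ σ : Equiv.Perm (Fin N), ((Equiv.Perm.sign σ : ℤ) : ℚ) • mon (α ∘ σ) := by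
  rw [alt, Matrix.det_apply]
  refine Finset.sum_congr rfl fun σ _ => ?_
  rw [Units.smul_def, Int.cast_smul_eq_zsmul]
  rfl

lemma alt_zero (α : Fin N → ℕ) (j j' : Fin N) (h : j ≠ j') (h2 : α j = α j') : alt α = 0 := by
  refine Matrix.det_zero_of_row_eq h ?_
  ext i
  simp [h2]

noncomputable def VV (N : ℕ) : MvPolynomial (Fin N) ℚ := alt (fun j => j.val)

lemma VV_vand : VV N = (Matrix.vandermonde (X : Fin N → MvPolynomial (Fin N) ℚ)).det := by
  rw [← Matrix.det_transpose]; rfl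

lemma VV_ne : VV N ≠ 0 := by
  rw [VV_vand, Matrix.det_vandermonde_ne_zero_iff]
  exact MvPolynomial.X_injective

lemma mon_update (e : Fin N → ℕ) (i : Fin N) (l : ℕ) :
    mon (Function.update e i l) = X i ^ l * ∏ k ∈ Finset.univ.erase i, X k ^ e k := by
  rw [mon, ← Finset.mul_prod_erase _ _ (Finset.mem_univ i)]
  congr 1
  · simp
  · refine Finset.prod_congr rfl fun k hk => ?_
    rw [Function.update_of_ne (by simpa using hk)]

lemma pderiv_rest (e : Fin N → ℕ) (i : Fin N) :
    pderiv i (∏ k ∈ Finset.univ.erase i, X k ^ e k : MvPolynomial (Fin N) ℚ) = 0 := by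
  rw [pderiv_prod']
  refine Finset.sum_eq_zero fun k hk => ?_
  rw [pderiv_pow, pderiv_X_of_ne (by simpa using hk)]; simp

lemma pderiv_mon_update (e : Fin N → ℕ) (i : Fin N) (l : ℕ) :
    pderiv i (mon (Function.update e i l)) = (l : ℚ) • mon (Function.update e i (l-1)) := by
  rw [mon_update, mon_update, pderiv_mul, pderiv_rest, pderiv_pow, pderiv_X_self, smul_eq_C_mul]
  simp; ring

/-- x + d/dx -/
noncomputable def yy (i : Fin N) : Module.End ℚ (MvPolynomial (Fin N) ℚ) :=
  LinearMap.mulLeft ℚ (X i) + (pderiv i).toLinearMap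

lemma yy_apply (i : Fin N) (f : MvPolynomial (Fin N) ℚ) : yy i f = X i * f + pderiv i f := by
  simp [yy]

lemma yy_mon (e : Fin N → ℕ) (i : Fin N) (l : ℕ) :
    yy i (mon (Function.update e i l)) = mon (Function.update e i (l+1))
      + (l : ℚ) • mon (Function.update e i (l-1)) := by
  rw [yy_apply, pderiv_mon_update, mon_update, mon_update e i (l+1)]
  congr 1; ring

def tt : ℕ → ℕ → ℕ → ℚ
  | 0, j, l => if j = l then 1 else 0
  | q+1, j, 0 => tt q j 1
  | q+1, j, l+1 => tt q j l + (l+2) * tt q j (l+2)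

lemma tt_big (q j l : ℕ) (h : j + q < l) : tt q j l = 0 := by
  induction q generalizing l with
  | zero => simp [tt]; omega
  | succ q ih =>
    rcases l with _ | l
    · omega
    · rw [tt, ih _ (by omega), ih _ (by omega)]; simp

lemma tt_small (q j l : ℕ) (h : l + q < j) : tt q j l = 0 := by
  induction q generalizing l with
  | zero => simp [tt]; omega
  | succ q ih =>
    rcases l with _ | l
    · rw [tt, ih _ (by omega)]
    · rw [tt, ih _ (by omega), ih _ (by omega)]; simp

lemma yy_pow_mon (q : ℕ) (e : Fin N → ℕ) (i : Fin N) (B : ℕ) (hB : e i + q < B) :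
    (yy i ^ q) (mon e) = ∑ l ∈ Finset.range B, tt q (e i) l • mon (Function.update e i l) := by
  induction q generalizing B with
  | zero =>
    rw [Finset.sum_eq_single (e i)]
    · simp [tt]
    · intro b _ hb; simp [tt, Ne.symm hb]
    · intro h; simp at h; omega
  | succ q ih =>
    rw [pow_succ', Module.End.mul_apply, ih (B+1) (by omega), map_sum]
    simp only [map_smul, yy_mon, smul_add, Finset.sum_add_distrib]
    obtain ⟨B, rfl⟩ : ∃ B', B = B' + 1 := ⟨B - 1, by omega⟩
    rw [Finset.sum_range_succ _ (B+1), Finset.sum_range_succ _ B, tt_big q _ (B+1) (by omega),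
      tt_big q _ B (by omega), Finset.sum_range_succ' _ (B+1), Finset.sum_range_succ' _ B,
      Finset.sum_range_succ' _ B]
    simp only [tt, add_smul, Finset.sum_add_distrib, zero_smul, add_zero, Nat.cast_zero, smul_zero,
      smul_smul]
    rw [add_assoc]
    congr 1
    congr 1
    · refine Finset.sum_congr rfl fun l _ => ?_
      congr 1
      push_cast; ring
    · simp

lemma alt_op (T : Fin N → Module.End ℚ (MvPolynomial (Fin N) ℚ)) (τ : ℕ → ℕ → ℚ) (α : Fin N → ℕ)
    (B : ℕ)
    (hT : ∀ (e : Fin N → ℕ) i, (∃ j, e i = α j) →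
      T i (mon e) = ∑ l ∈ Finset.range B, τ (e i) l • mon (Function.update e i l)) :
    ∑ i, T i (alt α) = ∑ j, ∑ l ∈ Finset.range B, τ (α j) l • alt (Function.update α j l) := by
  simp only [alt_eq, map_sum, map_smul, Finset.smul_sum]
  rw [Finset.sum_comm]
  have : ∀ j, ∑ l ∈ Finset.range B, ∑ σ : Equiv.Perm (Fin N), τ (α j) l •
      ((Equiv.Perm.sign σ : ℤ) : ℚ) • mon (Function.update α j l ∘ σ) =
      ∑ σ : Equiv.Perm (Fin N), ∑ l ∈ Finset.range B, τ (α j) l •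
      ((Equiv.Perm.sign σ : ℤ) : ℚ) • mon (Function.update α j l ∘ σ) := fun j => Finset.sum_comm
  simp only [this]
  rw [Finset.sum_comm (s := Finset.univ (α := Fin N))]
  refine Finset.sum_congr rfl fun σ _ => ?_
  symm
  rw [← Equiv.sum_comp σ]
  symm
  refine Finset.sum_congr rfl fun i _ => ?_
  rw [hT (α ∘ σ) i ⟨σ i, rfl⟩, Finset.smul_sum]
  refine Finset.sum_congr rfl fun l _ => ?_
  rw [smul_comm]
  congr 3
  funext k
  by_cases h : k = i
  · subst h; simp
  · rw [Function.update_of_ne h]; simp [Function.update_of_ne (σ.injective.ne h)]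

lemma lap_VV : lap id (VV N) = 0 := by
  have h := alt_op (N := N) (fun i => (pderiv i).toLinearMap ∘ₗ (pderiv i).toLinearMap)
    (fun j l => if l + 2 = j then (j * (j-1) : ℚ) else 0) (fun j => j.val) N (by
      intro e i hj
      obtain ⟨j, hj⟩ := hj
      have he : mon e = mon (Function.update e i (e i)) := by simp
      have h1 : ∀ l, l < N → (pderiv i) ((pderiv i) (mon (Function.update e i l))) =
        ∑ l' ∈ Finset.range N, (if l' + 2 = l then (l * (l-1) : ℚ) else 0) •
          mon (Function.update e i l') := by
        intro l hl
        rw [pderiv_mon_update, Derivation.map_smul, pderiv_mon_update, smul_smul]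
        rcases l with _ | _ | l
        · simp
        · simp
        · rw [Finset.sum_eq_single l]
          · simp
          · intro b _ hb; rw [if_neg (by omega), zero_smul]
          · intro h; simp at h; omega
      change pderiv i (pderiv i (mon e)) = _
      nth_rewrite 1 [he]
      exact h1 (e i) (by rw [hj]; exact j.2))
  rw [lap_apply]
  change ∑ i, pderiv i (pderiv i (VV N)) = _ at h
  simp only [id]
  rw [h]
  refine Finset.sum_eq_zero fun j _ => Finset.sum_eq_zero fun l hl => ?_
  by_cases h2 : l + 2 = j.val
  · rw [alt_zero _ j ⟨l, by simpa using hl⟩, smul_zero]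
    · intro h3; rw [h3] at h2; simp at h2
    · rw [Function.update_self, Function.update_of_ne]
      intro h3; rw [← h3] at h2; simp at h2
  · rw [if_neg h2, zero_smul]

noncomputable def EE (N : ℕ) : Finset (Fin N × Fin N) := Finset.univ.filter fun e => e.1 < e.2

lemma VV_prod : VV N = ∏ e ∈ EE N, (X e.2 - X e.1) := by
  rw [VV_vand, Matrix.det_vandermonde]
  symm
  exact Finset.prod_finset_product' (f := fun i j => (X j - X i : MvPolynomial (Fin N) ℚ))
    (EE N) Finset.univ (fun i => Finset.Ioi i) (by intro p; simp [EE])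

lemma VV_euler (r : ℕ) : ∑ k, X k ^ r * pderiv k (VV N) =
    ∑ e ∈ EE N, (∏ v ∈ (EE N).erase e, (X v.2 - X v.1)) * (X e.2 ^ r - X e.1 ^ r) := by
  rw [VV_prod]
  simp only [pderiv_prod', Finset.mul_sum]
  rw [Finset.sum_comm]
  refine Finset.sum_congr rfl fun e _ => ?_
  have h : ∀ b : Fin N, ∑ k, (X k ^ r * pderiv k (X b) : MvPolynomial (Fin N) ℚ) = X b ^ r := by
    intro b
    rw [Finset.sum_eq_single b]
    · simp
    · intro k _ hk; rw [pderiv_X_of_ne (Ne.symm hk), mul_zero]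
    · simp
  rw [← h e.2, ← h e.1, ← Finset.sum_sub_distrib, Finset.mul_sum]
  refine Finset.sum_congr rfl fun k _ => ?_
  rw [map_sub]; ring

lemma VV_euler0 : ∑ k, pderiv k (VV N) = 0 := by
  have := VV_euler (N := N) 0
  simpa using this

lemma VV_euler_succ (m : ℕ) : 2 * ∑ k, X k ^ (m+1) * pderiv k (VV N) =
    VV N * (∑ a ∈ Finset.range (m+1), pw N a * pw N (m-a) - (m+1) * pw N m) := by
  have h1 : ∑ k, X k ^ (m+1) * pderiv k (VV N) = VV N * ∑ e ∈ EE N,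
      ∑ a ∈ Finset.range (m+1), X e.2 ^ a * X e.1 ^ (m-a) := by
    rw [VV_euler, Finset.mul_sum]
    refine Finset.sum_congr rfl fun e he => ?_
    rw [← (Commute.all (X e.2 : MvPolynomial (Fin N) ℚ) (X e.1)).mul_geom_sum₂ (m+1), ← mul_assoc]
    congr 1
    rw [mul_comm, VV_prod, Finset.mul_prod_erase (EE N) (fun e => (X e.2 - X e.1 : MvPolynomial (Fin N) ℚ)) he]
  rw [h1]
  have h2 : ∑ a ∈ Finset.range (m+1), pw N a * pw N (m-a) =
      ∑ e : Fin N × Fin N, ∑ a ∈ Finset.range (m+1), X e.2 ^ a * X e.1 ^ (m-a) := by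
    rw [Finset.sum_comm]
    refine Finset.sum_congr rfl fun a _ => ?_
    rw [pw, pw, Finset.sum_mul_sum, Fintype.sum_prod_type, Finset.sum_comm]
  set F : Fin N × Fin N → MvPolynomial (Fin N) ℚ :=
    fun e => ∑ a ∈ Finset.range (m+1), X e.2 ^ a * X e.1 ^ (m-a) with hF
  have hsym : ∀ e, F e.swap = F e := by
    intro e
    simp only [hF]
    rw [← Finset.sum_range_reflect]
    refine Finset.sum_congr rfl fun a ha => ?_
    simp only [Finset.mem_range] at ha
    simp only [Prod.snd_swap, Prod.fst_swap]
    rw [show m + 1 - 1 - a = m - a by omega, show m - (m - a) = a by omega, mul_comm]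
  have h3 : ∑ e : Fin N × Fin N, F e = ∑ e ∈ EE N, F e + ∑ e ∈ EE N, F e + (m+1) * pw N m := by
    rw [← Finset.sum_filter_add_sum_filter_not Finset.univ (fun e : Fin N × Fin N => e.1 < e.2) F,
      add_assoc]
    congr 1
    rw [← Finset.sum_filter_add_sum_filter_not _ (fun e : Fin N × Fin N => e.2 < e.1) F]
    congr 1
    · refine Finset.sum_nbij' Prod.swap Prod.swap ?_ ?_ (by simp) (by simp) ?_
      · intro e he; simp [EE] at he ⊢; exact he.2
      · intro e he; simp [EE] at he ⊢; exact ⟨he.le, he⟩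
      · intro e _; rw [hsym]
    · have : ∑ i : Fin N, F (i, i) = (m+1) * pw N m := by
        rw [pw, Finset.mul_sum]
        refine Finset.sum_congr rfl fun i _ => ?_
        simp only [hF]
        rw [Finset.sum_congr rfl (g := fun _ => (X i : MvPolynomial (Fin N) ℚ) ^ m)]
        · simp
        · intro a ha
          simp only [Finset.mem_range] at ha
          rw [← pow_add]; congr 1; omega
      rw [← this]
      symm
      refine Finset.sum_nbij' (fun i => (i, i)) Prod.fst (by simp) (by simp) (by simp) ?_ (by simp)
      intro e he
      simp at he
      ext <;> simp
      exact congrArg _ (le_antisymm he.2 he.1)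
  rw [h2]
  change 2 * (VV N * ∑ e ∈ EE N, F e) = VV N * (∑ e, F e - _)
  rw [h3]; ring

end XSide
end PS

namespace PS
set_option linter.unusedSectionVars false
set_option linter.unusedSimpArgs false
open MvPolynomial

section XFinal
variable {N : ℕ}

noncomputable def OO (N q : ℕ) : Module.End ℚ (MvPolynomial (Fin N) ℚ) := ∑ i, yy i ^ q

lemma OO_alt (q : ℕ) (α : Fin N → ℕ) (B : ℕ) (hB : ∀ j, α j + q < B) :
    OO N q (alt α) = ∑ j, ∑ l ∈ Finset.range B, tt q (α j) l • alt (Function.update α j l) := by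
  rw [OO, LinearMap.sum_apply]
  refine alt_op (fun i => yy i ^ q) (tt q) α B ?_
  rintro e i ⟨j, hj⟩
  exact yy_pow_mon q e i B (by rw [hj]; exact hB j)

lemma UL_pw (q : ℕ) (w : MvPolynomial (Fin N) ℚ) :
    UL id (fun _ => rfl) (1/2) (pw N q * w) = OO N q (UL id (fun _ => rfl) (1/2) w) := by
  have h : ∀ i : Fin N, UL id (fun _ => rfl) (1/2) (X i ^ q * w)
      = (yy i ^ q) (UL id (fun _ => rfl) (1/2) w) := by
    intro i
    induction q with
    | zero => simp
    | succ q ih =>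
      rw [pow_succ', mul_assoc, UL_X_mul, ih, pow_succ', Module.End.mul_apply, yy_apply]
      norm_num
  rw [pw, Finset.sum_mul, map_sum, OO, LinearMap.sum_apply]
  exact Finset.sum_congr rfl fun i _ => h i

lemma mon_hom (e : Fin N → ℕ) : (mon e).IsHomogeneous (∑ j, e j) := by
  refine IsHomogeneous.prod _ _ _ fun i _ => ?_
  simpa using (isHomogeneous_X ℚ i).pow (e i)

lemma alt_hom (α : Fin N → ℕ) : (alt α).IsHomogeneous (∑ j, α j) := by
  rw [alt_eq]
  refine IsHomogeneous.sum _ _ _ fun σ _ => ?_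
  have := mon_hom (α ∘ σ)
  rw [show ∑ j, (α ∘ σ) j = ∑ j, α j from Equiv.sum_comp σ α] at this
  rw [smul_eq_C_mul]
  simpa using (isHomogeneous_C (Fin N) ((Equiv.Perm.sign σ : ℤ) : ℚ)).mul this

lemma hom_alt (α : Fin N → ℕ) (d : ℕ) :
    homogeneousComponent d (alt α) = if d = ∑ j, α j then alt α else 0 :=
  homogeneousComponent_of_mem (alt_hom α)

lemma sum_update (α : Fin N → ℕ) (j : Fin N) (l : ℕ) :
    ∑ i, Function.update α j l i + α j = ∑ i, α i + l := by
  rw [Finset.sum_update_of_mem (Finset.mem_univ j), ← Finset.sum_erase_add _ _ (Finset.mem_univ j),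
    Finset.sdiff_singleton_eq_erase]
  ring

def MM (N : ℕ) : ℕ := ∑ j : Fin N, j.val

lemma step1 (q s : ℕ) : homogeneousComponent (MM N + s) (OO N q (VV N)) =
    ∑ j : Fin N, tt q j.val (j.val + s) • alt (Function.update (fun j => j.val) j (j.val + s)) := by
  rw [VV, OO_alt q _ (N + q + s) (by intro j; have := j.2; omega), map_sum]
  refine Finset.sum_congr rfl fun j _ => ?_
  rw [map_sum, Finset.sum_eq_single (j.val + s)]
  · have := sum_update (fun j : Fin N => j.val) j (j.val + s)
    rw [map_smul, hom_alt, if_pos]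
    unfold MM; simp only at this ⊢; omega
  · intro l _ hl
    have := sum_update (fun j : Fin N => j.val) j l
    rw [map_smul, hom_alt, if_neg, smul_zero]
    unfold MM; simp only at this ⊢; omega
  · intro h
    rw [tt_big _ _ _ (by have := j.2; simp at h; omega)]; simp

lemma step2 (p s : ℕ) (hs : 1 ≤ s) (j : Fin N) (hj : N ≤ j.val + s) :
    homogeneousComponent (MM N) (OO N p (alt (Function.update (fun j => j.val) j (j.val + s)))) =
      tt p (j.val + s) j.val • VV N := by
  set α : Fin N → ℕ := Function.update (fun j => j.val) j (j.val + s) with hα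
  have hαj : α j = j.val + s := by simp [hα]
  have hαo : ∀ i, i ≠ j → α i = i.val := by intro i hi; simp [hα, hi]
  have hsum : ∑ i, α i = MM N + s := by
    have := sum_update (fun j : Fin N => j.val) j (j.val + s)
    unfold MM; simp only [hα] at this ⊢; omega
  have hbd : ∀ i, α i ≤ N + s := by
    intro i
    by_cases h : i = j
    · subst h; rw [hαj]; have := i.2; omega
    · rw [hαo i h]; have := i.2; omega
  rw [OO_alt p α (N + s + p + 1) (by intro i; have := hbd i; omega), map_sum,
    Finset.sum_eq_single j]
  · rw [map_sum, Finset.sum_eq_single j.val]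
    · have h2 : Function.update α j j.val = fun j => j.val := by
        rw [hα, Function.update_idem]; simp
      rw [map_smul, h2, hom_alt, hαj]
      unfold MM VV; simp
    · intro l _ hl
      have := sum_update α j l
      rw [map_smul, hom_alt, if_neg, smul_zero]
      rw [hsum, hαj] at this; omega
    · intro h; simp at h; have := j.2; omega
  · intro i _ hi
    rw [map_sum]
    refine Finset.sum_eq_zero fun l _ => ?_
    rw [map_smul, hom_alt]
    split_ifs with h
    · have := sum_update α i l
      rw [hsum, hαo i hi] at this
      have hl : l + s = i.val := by omega
      have hi2 := i.2
      rw [alt_zero _ i ⟨l, by omega⟩, smul_zero]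
      · intro h; have := congrArg Fin.val h; simp at this; omega
      · have h1 : (⟨l, by omega⟩ : Fin N) ≠ i := by
          intro h; have := congrArg Fin.val h; simp at this; omega
        have h2 : (⟨l, by omega⟩ : Fin N) ≠ j := by
          intro h; have := congrArg Fin.val h; simp at this; omega
        rw [Function.update_self, Function.update_of_ne h1, hαo _ h2]
    · rw [smul_zero]
  · simp

noncomputable def ff (N p q s : ℕ) : ℚ :=
  ∑ j : Fin N, if N ≤ j.val + s then tt q j.val (j.val + s) * tt p (j.val + s) j.val else 0

lemma step3 (p q s : ℕ) (hs : 1 ≤ s) :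
    homogeneousComponent (MM N) (OO N p (homogeneousComponent (MM N + s) (OO N q (VV N)))) =
      ff N p q s • VV N := by
  rw [step1, map_sum, map_sum, ff, Finset.sum_smul]
  refine Finset.sum_congr rfl fun j _ => ?_
  rw [map_smul, map_smul]
  split_ifs with h
  · rw [step2 p s hs j h, smul_smul]
  · rw [alt_zero _ j ⟨j.val + s, by omega⟩]
    · simp
    · intro h; have := congrArg Fin.val h; simp at this; omega
    · rw [Function.update_self, Function.update_of_ne]
      intro h; have := congrArg Fin.val h; simp at this; omega

end XFinal
end PS

namespace PS
set_option linter.unusedSectionVars false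
set_option linter.unusedSimpArgs false
open MvPolynomial

section MatSide
variable {N : ℕ}

noncomputable def AA (N : ℕ) : Matrix (Fin N) (Fin N) (MvPolynomial (Fin N × Fin N) ℚ) :=
  fun i j => X (i, j)

noncomputable def tr (N m : ℕ) : MvPolynomial (Fin N × Fin N) ℚ := (AA N ^ m).trace

lemma swsw : ∀ i : Fin N × Fin N, Prod.swap (Prod.swap i) = i := fun _ => rfl

lemma pderiv_AA (k l a b : Fin N) :
    pderiv (k,l) (AA N a b) = if a = k ∧ b = l then 1 else 0 := by
  rw [AA, pderiv_X, Pi.single_apply]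
  simp [Prod.ext_iff]

lemma pderiv_Apow (k l : Fin N) (m : ℕ) (a b : Fin N) :
    pderiv (k,l) ((AA N ^ m) a b)
      = ∑ u ∈ Finset.range m, (AA N ^ u) a k * (AA N ^ (m - 1 - u)) l b := by
  induction m generalizing b with
  | zero =>
    simp only [pow_zero, Finset.range_zero, Finset.sum_empty, Matrix.one_apply]
    split_ifs <;> simp
  | succ m ih =>
    rw [pow_succ, Matrix.mul_apply, map_sum]
    simp only [pderiv_mul, ih, pderiv_AA]
    rw [Finset.sum_add_distrib, Finset.sum_range_succ]
    congr 1
    · simp only [Finset.sum_mul]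
      rw [Finset.sum_comm]
      refine Finset.sum_congr rfl fun u hu => ?_
      rw [Finset.mem_range] at hu
      have : m + 1 - 1 - u = (m - 1 - u) + 1 := by omega
      rw [this, pow_succ, Matrix.mul_apply, Finset.mul_sum]
      refine Finset.sum_congr rfl fun j _ => ?_
      ring
    · rw [Finset.sum_eq_single k]
      · have : m + 1 - 1 - m = 0 := by omega
        rw [this, pow_zero, Matrix.one_apply]
        simp [eq_comm]
      · intro j _ hj; simp [hj]
      · simp

lemma pderiv_tr (k l : Fin N) (m : ℕ) :
    pderiv (k,l) (tr N (m+1)) = (m+1) * (AA N ^ m) l k := by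
  rw [tr, Matrix.trace, map_sum]
  simp only [Matrix.diag_apply, pderiv_Apow]
  rw [Finset.sum_comm]
  have : ∀ u ∈ Finset.range (m+1), ∑ a, (AA N ^ u) a k * (AA N ^ (m + 1 - 1 - u)) l a
      = (AA N ^ m) l k := by
    intro u hu
    rw [Finset.mem_range] at hu
    have : m = (m + 1 - 1 - u) + u := by omega
    conv_rhs => rw [this, pow_add, Matrix.mul_apply]
    refine Finset.sum_congr rfl fun j _ => ?_
    ring
  rw [Finset.sum_congr rfl this]
  simp

lemma tr_zero : tr N 0 = C (N : ℚ) := by simp [tr]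
lemma pw_zero : pw N 0 = C (N : ℚ) := by simp [pw]
lemma lap_tr0 : lap Prod.swap (tr N 0) = 0 := by rw [tr_zero, lap_C]
lemma lap_tr1 : lap Prod.swap (tr N 1) = 0 := by
  rw [lap_apply]
  refine Finset.sum_eq_zero fun ⟨k,l⟩ _ => ?_
  rw [Prod.swap_prod_mk, pderiv_tr l k 0]
  simp only [pow_zero, Matrix.one_apply]
  split_ifs <;> simp
lemma castC {ι : Type} (m : ℕ) : ((m : MvPolynomial ι ℚ) + 2) = C ((m:ℚ)+2) := by
  rw [map_add, map_ofNat, map_natCast]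
lemma castC' {ι : Type} (m : ℕ) : (((m+1 : ℕ) : MvPolynomial ι ℚ) + 1) = C ((m:ℚ)+2) := by
  rw [← castC]; push_cast; ring

lemma lap_tr (m : ℕ) : lap Prod.swap (tr N (m+2))
    = (m+2) * ∑ u ∈ Finset.range (m+1), tr N u * tr N (m-u) := by
  rw [lap_apply, Fintype.sum_prod_type]
  have : ∀ k l : Fin N, pderiv (k,l) (pderiv (Prod.swap (k,l)) (tr N (m+2)))
    = (m+2) * ∑ u ∈ Finset.range (m+1), (AA N ^ u) k k * (AA N ^ (m - u)) l l := by
    intro k l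
    rw [Prod.swap_prod_mk, pderiv_tr l k (m+1), castC, castC', pderiv_C_mul, pderiv_Apow]
    congr 1
  rw [Finset.sum_congr rfl fun k _ => Finset.sum_congr rfl fun l _ => this k l]
  rw [Finset.sum_congr rfl fun k _ => (Finset.mul_sum _ _ _).symm, ← Finset.mul_sum]
  refine congrArg _ ?_
  simp only [tr, Matrix.trace, Matrix.diag_apply]
  have h1 : ∀ u, (∑ x, (AA N ^ u) x x) * (∑ x, (AA N ^ (m-u)) x x)
      = ∑ x, ∑ i, (AA N ^ u) x x * (AA N ^ (m - u)) i i := fun u => Finset.sum_mul_sum ..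
  rw [Finset.sum_congr rfl fun u _ => h1 u]
  have h2 : ∀ x : Fin N, ∑ i, ∑ u ∈ Finset.range (m+1), (AA N ^ u) x x * (AA N ^ (m - u)) i i
    = ∑ u ∈ Finset.range (m+1), ∑ i, (AA N ^ u) x x * (AA N ^ (m - u)) i i :=
    fun x => Finset.sum_comm
  rw [Finset.sum_congr rfl fun x _ => h2 x, Finset.sum_comm]

noncomputable def Gam {ι : Type} [Fintype ι] [DecidableEq ι] (st : ι → ι) (f g : MvPolynomial ι ℚ) :
    MvPolynomial ι ℚ := ∑ i, pderiv i f * pderiv (st i) g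

lemma Gam_mul {ι : Type} [Fintype ι] [DecidableEq ι] (st : ι → ι) (f g h : MvPolynomial ι ℚ) :
    Gam st f (g * h) = Gam st f g * h + g * Gam st f h := by
  simp only [Gam, pderiv_mul, Finset.sum_mul, Finset.mul_sum, ← Finset.sum_add_distrib]
  refine Finset.sum_congr rfl fun i _ => ?_
  ring

lemma Gam_C_left {ι : Type} [Fintype ι] [DecidableEq ι] (st : ι → ι) (a : ℚ) (h : MvPolynomial ι ℚ) :
    Gam st (C a) h = 0 := by simp [Gam]
lemma Gam_C_right {ι : Type} [Fintype ι] [DecidableEq ι] (st : ι → ι) (a : ℚ) (h : MvPolynomial ι ℚ) :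
    Gam st h (C a) = 0 := by simp [Gam]

lemma Gam_tr (m r : ℕ) : Gam Prod.swap (tr N (m+1)) (tr N (r+1)) = (m+1)*(r+1) * tr N (m+r) := by
  rw [Gam, Fintype.sum_prod_type]
  simp only [Prod.swap_prod_mk, pderiv_tr]
  rw [tr, Matrix.trace, Finset.mul_sum, Finset.sum_comm]
  refine Finset.sum_congr rfl fun k _ => ?_
  rw [Matrix.diag_apply, pow_add, Matrix.mul_apply, Finset.mul_sum]
  refine Finset.sum_congr rfl fun l _ => ?_
  ring

lemma pderiv_pw (m : ℕ) (i : Fin N) : pderiv i (pw N (m+1)) = ((m : MvPolynomial (Fin N) ℚ)+1) * X i ^ m := by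
  rw [pw, map_sum, Finset.sum_eq_single i]
  · rw [pderiv_pow]; simp
  · intro j _ hj; rw [pderiv_pow, pderiv_X_of_ne hj]; simp
  · simp

lemma Gam_pw (m r : ℕ) : Gam id (pw N (m+1)) (pw N (r+1)) = (m+1)*(r+1) * pw N (m+r) := by
  rw [Gam]
  simp only [id, pderiv_pw]
  conv_rhs => rw [pw, Finset.mul_sum]
  refine Finset.sum_congr rfl fun k _ => ?_
  ring

lemma lap_pw (m : ℕ) : lap id (pw N (m+2)) = (m+2)*(m+1) * pw N m := by
  conv_rhs => rw [pw, Finset.mul_sum]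
  rw [lap_apply]
  refine Finset.sum_congr rfl fun k _ => ?_
  have := pderiv_pw (m+1) k
  rw [id, this, castC, castC', pderiv_C_mul, pderiv_pow]; simp; ring

lemma lap_pw1 : lap id (pw N 1) = 0 := by
  rw [lap_apply]
  refine Finset.sum_eq_zero fun k _ => ?_
  rw [id, pderiv_pw 0 k]; simp

end MatSide
end PS

namespace PS
set_option linter.unusedSectionVars false
set_option linter.unusedSimpArgs false
open MvPolynomial

section RelSec
variable {N : ℕ}

abbrev RR (N : ℕ) := MvPolynomial (Fin N × Fin N) ℚ
abbrev XX (N : ℕ) := MvPolynomial (Fin N) ℚ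

noncomputable def gt (N : ℕ) (l : List ℕ) : RR N := (l.map (tr N)).prod
noncomputable def gp (N : ℕ) (l : List ℕ) : XX N := (l.map (pw N)).prod

lemma gt_cons (a : ℕ) (l : List ℕ) : gt N (a :: l) = tr N a * gt N l := by simp [gt]
lemma gp_cons (a : ℕ) (l : List ℕ) : gp N (a :: l) = pw N a * gp N l := by simp [gp]

noncomputable def Rel (N : ℕ) : Submodule ℚ (RR N × XX N) :=
  Submodule.span ℚ (Set.range fun l : List ℕ => (gt N l, VV N * gp N l))

lemma Rel_gen (l : List ℕ) : (gt N l, VV N * gp N l) ∈ Rel N :=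
  Submodule.subset_span ⟨l, rfl⟩

lemma Rel_map (F : RR N →ₗ[ℚ] RR N) (G : XX N →ₗ[ℚ] XX N)
    (h : ∀ l, (F (gt N l), G (VV N * gp N l)) ∈ Rel N) (r : RR N) (w : XX N)
    (hrw : (r, w) ∈ Rel N) : (F r, G w) ∈ Rel N := by
  have : Rel N ≤ (Rel N).comap (LinearMap.prodMap F G) := by
    rw [Rel, Submodule.span_le]
    rintro _ ⟨l, rfl⟩
    exact h l
  exact this hrw

lemma Rel_mul (m : ℕ) (r : RR N) (w : XX N) (h : (r, w) ∈ Rel N) :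
    (tr N m * r, pw N m * w) ∈ Rel N := by
  refine Rel_map (LinearMap.mulLeft ℚ (tr N m)) (LinearMap.mulLeft ℚ (pw N m)) ?_ r w h
  intro l
  have := Rel_gen (N := N) (m :: l)
  rw [gt_cons, gp_cons] at this
  simp only [LinearMap.mulLeft_apply]
  convert this using 2
  ring

lemma Rel_smul (a : ℚ) (r : RR N) (w : XX N) (h : (r, w) ∈ Rel N) :
    (C a * r, C a * w) ∈ Rel N := by
  have := (Rel N).smul_mem a h
  rwa [Prod.smul_mk, smul_eq_C_mul, smul_eq_C_mul] at this

lemma Rel_add (r r' : RR N) (w w' : XX N) (h : (r, w) ∈ Rel N) (h' : (r', w') ∈ Rel N) :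
    (r + r', w + w') ∈ Rel N := (Rel N).add_mem h h'

lemma Rel_sum {α : Type} (s : Finset α) (r : α → RR N) (w : α → XX N)
    (h : ∀ a ∈ s, (r a, w a) ∈ Rel N) :
    (∑ a ∈ s, r a, ∑ a ∈ s, w a) ∈ Rel N := by
  have := (Rel N).sum_mem h
  convert this using 1
  ext1
  · rw [Prod.fst_sum]
  · rw [Prod.snd_sum]

lemma Rel_zero : ((0 : RR N), (0 : XX N)) ∈ Rel N := (Rel N).zero_mem

lemma Rel_Gam (m : ℕ) (l : List ℕ) :
    (Gam Prod.swap (tr N m) (gt N l), VV N * Gam id (pw N m) (gp N l)) ∈ Rel N := by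
  induction l with
  | nil =>
    have h1 : gt N [] = C 1 := by simp [gt]
    have h2 : gp N [] = C 1 := by simp [gp]
    rw [h1, h2, Gam_C_right, Gam_C_right, mul_zero]; exact Rel_zero
  | cons a l ih =>
    rw [gt_cons, gp_cons, Gam_mul, Gam_mul, mul_add]
    refine Rel_add _ _ _ _ ?_ ?_
    · rcases m with _ | m
      · rw [tr_zero, pw_zero, Gam_C_left, Gam_C_left]; simpa using Rel_zero
      rcases a with _ | a
      · rw [tr_zero, pw_zero, Gam_C_right, Gam_C_right]; simpa using Rel_zero
      rw [Gam_tr, Gam_pw]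
      have := Rel_smul ((m+1)*(a+1)) _ _ (Rel_mul (m+a) _ _ (Rel_gen (N := N) l))
      convert this using 2
      · simp; ring
      · simp; ring
    · have := Rel_mul a _ _ ih
      convert this using 2
      ring

lemma lap_mul2 {ι : Type} [Fintype ι] [DecidableEq ι] (st : ι → ι) (hst : ∀ i, st (st i) = i) (f g : MvPolynomial ι ℚ) :
    lap st (f * g) = lap st f * g + C 2 * Gam st f g + f * lap st g := by
  rw [lap_mul st hst, Gam, map_ofNat]

lemma Rel_lapm (m : ℕ) (l : List ℕ) :
    (lap Prod.swap (tr N m) * gt N l,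
      lap id (pw N m) * (VV N * gp N l) + C 2 * (Gam id (pw N m) (VV N) * gp N l)) ∈ Rel N := by
  rcases m with _ | _ | m
  · rw [lap_tr0, pw_zero, lap_C, Gam_C_left]; simpa using Rel_zero
  · have : Gam id (pw N (0+1)) (VV N) = 0 := by
      rw [Gam]; simp only [pderiv_pw]
      have := VV_euler0 (N := N)
      simpa using this
    rw [this, zero_add, lap_tr1, lap_pw1]; simpa using Rel_zero
  · have h : C 2 * Gam id (pw N (m+2)) (VV N) = C ((m:ℚ)+2) * (VV N * (∑ a ∈ Finset.range (m+1), pw N a * pw N (m-a) - ((m : XX N)+1) * pw N m)) := by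
      rw [← VV_euler_succ, Gam]
      simp only [pderiv_pw, castC']
      rw [map_ofNat, Finset.mul_sum, Finset.mul_sum, Finset.mul_sum]
      refine Finset.sum_congr rfl fun k _ => ?_
      simp only [id]
      ring
    have h2 : lap id (pw N (m+2)) * (VV N * gp N l) + C 2 * (Gam id (pw N (m+2)) (VV N) * gp N l)
      = C ((m:ℚ)+2) * ∑ a ∈ Finset.range (m+1), pw N a * (pw N (m-a) * (VV N * gp N l)) := by
      rw [← mul_assoc (C 2), h, lap_pw, castC]
      simp only [← mul_assoc, ← Finset.sum_mul]
      ring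
    have h3 : lap Prod.swap (tr N (m+2)) * gt N l
      = C ((m:ℚ)+2) * ∑ a ∈ Finset.range (m+1), tr N a * (tr N (m-a) * gt N l) := by
      rw [lap_tr, castC]
      simp only [← mul_assoc, ← Finset.sum_mul]
    rw [h2, h3]
    refine Rel_smul _ _ _ (Rel_sum _ _ _ fun a _ => Rel_mul _ _ _ (Rel_mul _ _ _ (Rel_gen l)))

lemma Rel_lap_gen (l : List ℕ) :
    (lap Prod.swap (gt N l), lap id (VV N * gp N l)) ∈ Rel N := by
  induction l with
  | nil =>
    have h1 : gt N [] = C 1 := by simp [gt]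
    have h2 : gp N [] = 1 := by simp [gp]
    rw [h1, h2, mul_one, lap_VV, lap_C]; exact Rel_zero
  | cons a l ih =>
    rw [gt_cons, gp_cons, mul_left_comm, lap_mul2 _ swsw, lap_mul2 _ (fun _ => rfl), Gam_mul]
    refine Rel_add _ _ _ _ ?_ (Rel_mul _ _ _ ih)
    have := Rel_add (N := N) _ _ _ _ (Rel_lapm a l) (Rel_smul 2 _ _ (Rel_Gam a l))
    convert this using 2
    ring

lemma Rel_lap (r : RR N) (w : XX N) (h : (r, w) ∈ Rel N) :
    (lap Prod.swap r, lap id w) ∈ Rel N := Rel_map _ _ Rel_lap_gen r w h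

lemma Rel_lapn (n : ℕ) (r : RR N) (w : XX N) (h : (r, w) ∈ Rel N) :
    ((lap Prod.swap ^ n) r, (lap id ^ n) w) ∈ Rel N := by
  induction n with
  | zero => simpa using h
  | succ n ih =>
    rw [pow_succ', pow_succ', Module.End.mul_apply, Module.End.mul_apply]
    exact Rel_lap _ _ ih

lemma Rel_UL (c : ℚ) (r : RR N) (w : XX N) (h : (r, w) ∈ Rel N) :
    (UL Prod.swap swsw c r, UL id (fun _ => rfl) c w) ∈ Rel N := by
  obtain ⟨K, hK⟩ := UL_mem Prod.swap swsw c r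
  obtain ⟨K', hK'⟩ := UL_mem id (fun _ => rfl) c w
  rw [hK (max K K') (le_max_left _ _), hK' (max K K') (le_max_right _ _)]
  refine Rel_sum _ _ _ fun n _ => ?_
  rw [smul_eq_C_mul, smul_eq_C_mul]
  exact Rel_smul _ _ _ (Rel_lapn n _ _ h)

lemma Apow_hom (m : ℕ) (a b : Fin N) : ((AA N ^ m) a b).IsHomogeneous m := by
  induction m generalizing b with
  | zero =>
    rw [pow_zero, Matrix.one_apply]
    split_ifs
    · exact isHomogeneous_one _ _
    · exact isHomogeneous_zero _ _ _
  | succ m ih =>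
    rw [pow_succ, Matrix.mul_apply]
    exact IsHomogeneous.sum _ _ _ fun j _ => (ih j).mul (isHomogeneous_X _ _)

lemma tr_hom (m : ℕ) : (tr N m).IsHomogeneous m :=
  IsHomogeneous.sum _ _ _ fun j _ => Apow_hom m j j

lemma pw_hom (m : ℕ) : (pw N m).IsHomogeneous m :=
  IsHomogeneous.sum _ _ _ fun _ _ => isHomogeneous_X_pow _ _

lemma gt_hom (l : List ℕ) : (gt N l).IsHomogeneous l.sum := by
  induction l with
  | nil => simpa [gt] using isHomogeneous_one _ _
  | cons a l ih => rw [gt_cons, List.sum_cons]; exact (tr_hom a).mul ih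

lemma gp_hom (l : List ℕ) : (gp N l).IsHomogeneous l.sum := by
  induction l with
  | nil => simpa [gp] using isHomogeneous_one _ _
  | cons a l ih => rw [gp_cons, List.sum_cons]; exact (pw_hom a).mul ih

lemma VV_hom : (VV N).IsHomogeneous (MM N) := alt_hom _

lemma Rel_hom (d : ℕ) (r : RR N) (w : XX N) (h : (r, w) ∈ Rel N) :
    (homogeneousComponent d r, homogeneousComponent (MM N + d) w) ∈ Rel N := by
  refine Rel_map _ _ (fun l => ?_) r w h
  rw [homogeneousComponent_of_mem (gt_hom l), homogeneousComponent_of_mem (VV_hom.mul (gp_hom l))]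
  by_cases h : d = l.sum
  · subst h; simpa using Rel_gen l
  · rw [if_neg h, if_neg (by omega)]; exact Rel_zero

lemma Rel_cc (r : RR N) (w : XX N) (h : (r, w) ∈ Rel N) :
    homogeneousComponent (MM N) w = constantCoeff r • VV N := by
  have key : ∀ l : List ℕ, homogeneousComponent (MM N) (VV N * gp N l) = constantCoeff (gt N l) • VV N := by
    intro l
    rw [homogeneousComponent_of_mem (VV_hom.mul (gp_hom l))]
    by_cases h : l.sum = 0
    · rw [if_pos (by omega)]
      have : gp N l = C (constantCoeff (gt N l)) := by
        induction l with
        | nil => simp [gp, gt]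
        | cons a l ih =>
          rw [List.sum_cons] at h
          obtain ⟨rfl, h2⟩ : a = 0 ∧ l.sum = 0 := by omega
          rw [gp_cons, gt_cons, ih h2, tr_zero, pw_zero]
          simp
      rw [this, mul_comm, smul_eq_C_mul]
    · rw [if_neg (by omega)]
      have : constantCoeff (gt N l) = 0 := by
        rw [constantCoeff_eq]
        exact (gt_hom l).coeff_eq_zero (by simpa using Ne.symm h)
      rw [this, zero_smul]
  rw [Rel] at h
  have : Submodule.span ℚ (Set.range fun l : List ℕ => (gt N l, VV N * gp N l)) ≤
      LinearMap.eqLocus ((homogeneousComponent (MM N)) ∘ₗ LinearMap.snd ℚ (RR N) (XX N))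
        ((LinearMap.toSpanSingleton ℚ _ (VV N)) ∘ₗ (lcoeff ℚ 0) ∘ₗ LinearMap.fst ℚ (RR N) (XX N)) := by
    rw [Submodule.span_le]
    rintro _ ⟨l, rfl⟩
    exact key l
  exact this h

theorem QQ_ff (p q s : ℕ) (hs : 1 ≤ s) :
    QQ Prod.swap swsw s (tr N p) (tr N q) = ff N p q s := by
  have h0 : ((1 : RR N), VV N) ∈ Rel N := by simpa [gt, gp] using Rel_gen (N := N) []
  have h1 := Rel_UL (1/2) _ _ (Rel_mul q _ _ h0)
  rw [UL_pw, UL_fix _ _ _ (VV N) lap_VV, mul_one] at h1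
  have h2 := Rel_UL (1/2) _ _ (Rel_mul p _ _ (Rel_UL (-(1/2)) _ _ (Rel_hom s _ _ h1)))
  rw [UL_pw, UL_inv] at h2
  have h3 := Rel_cc _ _ h2
  rw [step3 p q s hs] at h3
  have h4 : (ff N p q s - constantCoeff (UL Prod.swap swsw (1/2) (tr N p * UL Prod.swap swsw (-(1/2)) (homogeneousComponent s (UL Prod.swap swsw (1/2) (tr N q)))))) • VV N = 0 := by
    rw [sub_smul, h3, sub_self]
  rcases smul_eq_zero.mp h4 with h5 | h5
  · rw [QQ]; linarith
  · exact absurd h5 VV_ne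

end RelSec
end PS

namespace PS
set_option linter.unusedSectionVars false
set_option linter.unusedSimpArgs false
open MvPolynomial

section Cnt
variable {N : ℕ}

lemma path (m : ℕ) (a b : Fin N) : (AA N ^ (m+1)) a b =
    ∑ φ : Fin m → Fin N, ∏ i : Fin (m+1),
      AA N ((Fin.cons a φ : Fin (m+1) → Fin N) i) ((Fin.snoc φ b : Fin (m+1) → Fin N) i) := by
  induction m generalizing a with
  | zero => simp [Fin.snoc]
  | succ m ih =>
    rw [pow_succ', Matrix.mul_apply, ← (Fin.consEquiv (fun _ : Fin (m+1) => Fin N)).sum_comp,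
      Fintype.sum_prod_type]
    refine Finset.sum_congr rfl fun c _ => ?_
    rw [ih, Finset.mul_sum]
    refine Finset.sum_congr rfl fun φ _ => ?_
    conv_rhs => rw [Fin.prod_univ_succ]
    have h : (Fin.snoc (Fin.cons c φ : Fin (m+1) → Fin N) b : Fin (m+2) → Fin N)
      = Fin.cons c (Fin.snoc φ b : Fin (m+1) → Fin N) := (Fin.cons_snoc_eq_snoc_cons _ _ _).symm
    change _ = AA N a ((Fin.snoc (Fin.cons c φ : Fin (m+1) → Fin N) b : Fin (m+2) → Fin N) 0) *
      ∏ i : Fin (m+1), AA N ((Fin.cons c φ : Fin (m+1) → Fin N) i)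
        ((Fin.snoc (Fin.cons c φ : Fin (m+1) → Fin N) b : Fin (m+2) → Fin N) i.succ)
    rw [h]
    rfl

lemma tr_eq (m : ℕ) : tr N (m+1) = ∑ φ : Fin (m+1) → Fin N, ∏ i, X (φ i, φ (finRotate (m+1) i)) := by
  rw [tr, Matrix.trace, ← (Fin.consEquiv (fun _ : Fin (m+1) => Fin N)).sum_comp,
      Fintype.sum_prod_type]
  refine Finset.sum_congr rfl fun a _ => ?_
  rw [Matrix.diag_apply, path]
  refine Finset.sum_congr rfl fun φ _ => ?_
  rw [Fin.snoc_eq_cons_rotate]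
  rfl

abbrev gam (p q : ℕ) : Fin p ⊕ Fin q ≃ Fin p ⊕ Fin q := Equiv.sumCongr (finRotate p) (finRotate q)

abbrev cc {p q : ℕ} (φ : Fin p ⊕ Fin q → Fin N) : Fin p ⊕ Fin q → Fin N × Fin N :=
  fun v => (φ v, φ (gam p q v))

lemma sum_PSet (p q s : ℕ) (hp : 1 ≤ p) (hq : 1 ≤ q) :
    ∑ φ : Fin p ⊕ Fin q → Fin N, ((PSet Prod.swap (cc φ) Sum.isLeft Finset.univ s).card : ℚ)
      = QQ Prod.swap swsw s (tr N p) (tr N q) := by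
  obtain ⟨p, rfl⟩ := Nat.exists_eq_add_of_le' hp
  obtain ⟨q, rfl⟩ := Nat.exists_eq_add_of_le' hq
  rw [tr_eq, tr_eq, QQ_sum_left]
  simp only [QQ_sum_right]
  rw [← (Equiv.sumArrowEquivProdArrow _ _ _).symm.sum_comp, Fintype.sum_prod_type]
  refine Finset.sum_congr rfl fun φ _ => Finset.sum_congr rfl fun ψ _ => ?_
  rw [wick Prod.swap swsw _ _ _ _ _ rfl]
  congr 1
  · rw [Finset.prod_filter, Fintype.prod_sum_type]
    simp only [Sum.isLeft_inl, Sum.isLeft_inr, if_true, Bool.false_eq_true, Bool.true_eq_false, if_false, Finset.prod_const_one, mul_one, one_mul]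
    rfl
  · rw [Finset.prod_filter, Fintype.prod_sum_type]
    simp only [Sum.isLeft_inl, Sum.isLeft_inr, if_true, Bool.false_eq_true, Bool.true_eq_false, if_false, Finset.prod_const_one, mul_one, one_mul]
    rfl

/-- the set of pairs without surjectivity -/
def TP (p q s N : ℕ) (x : Equiv.Perm (Fin p ⊕ Fin q) × ((Fin p ⊕ Fin q) → Fin N)) : Prop :=
    (∀ v, x.1 (x.1 v) = v) ∧ (∀ v, x.1 v ≠ v) ∧
    (Finset.univ.filter fun i : Fin p => (x.1 (Sum.inl i)).isRight).card = s ∧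
    ∀ v, x.2 (x.1 v) = x.2 (gam p q v)

lemma mem_PSet_iff (p q s : ℕ) (μ : Equiv.Perm (Fin p ⊕ Fin q)) (φ : Fin p ⊕ Fin q → Fin N) :
    μ ∈ PSet Prod.swap (cc φ) Sum.isLeft Finset.univ s ↔ TP p q s N (μ, φ) := by
  rw [mem_PSet, TP]
  have hc : (Finset.univ.filter fun v : Fin p ⊕ Fin q => v.isLeft = true ∧ (μ v).isLeft = false).card
      = (Finset.univ.filter fun i : Fin p => (μ (Sum.inl i)).isRight).card := by
    symm
    rw [← Finset.card_map ⟨Sum.inl, Sum.inl_injective⟩]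
    congr 1
    ext v
    rcases v with v | v <;> simp
  rw [hc]
  simp only [Finset.mem_univ, true_iff, forall_true_left, cc, Prod.swap_prod_mk, Prod.mk.injEq]
  constructor
  · rintro ⟨h1, h2, h3, h4⟩
    exact ⟨h1, h2, h4, fun v => (h3 v).1⟩
  · rintro ⟨h1, h2, h4, h3⟩
    refine ⟨h1, h2, fun v => ⟨h3 v, ?_⟩, h4⟩
    have := h3 (μ v)
    rw [h1 v] at this
    exact this.symm

open Classical in
noncomputable def TT (p q s N : ℕ) : Finset (Equiv.Perm (Fin p ⊕ Fin q) × ((Fin p ⊕ Fin q) → Fin N)) :=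
  Finset.univ.filter (TP p q s N)

lemma card_TT (p q s : ℕ) (hp : 1 ≤ p) (hq : 1 ≤ q) (hs : 1 ≤ s) :
    ((TT p q s N).card : ℚ) = ff N p q s := by
  classical
  rw [← QQ_ff p q s hs, ← sum_PSet p q s hp hq]
  rw [Finset.card_eq_sum_card_fiberwise (f := Prod.snd) (t := Finset.univ) (by simp)]
  push_cast
  refine Finset.sum_congr rfl fun φ _ => ?_
  congr 1
  symm
  refine Finset.card_bij (fun μ _ => (μ, φ)) ?_ ?_ ?_
  · intro μ hμ
    rw [mem_PSet_iff] at hμ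
    simp [TT, hμ]
  · intro a _ b _ h; simpa using h
  · rintro ⟨μ, ψ⟩ h
    simp only [TT, Finset.mem_filter, Finset.mem_univ, true_and] at h
    obtain ⟨h, rfl⟩ := h
    exact ⟨μ, (mem_PSet_iff p q s μ ψ).2 h, rfl⟩

lemma card_fiber2 (p q s : ℕ) (I : Finset (Fin N)) [DecidableEq (Finset (Fin N))] :
    ((TT p q s N).filter fun x => Finset.univ.image x.2 = I).card = psCount p q s I.card := by
  classical
  rw [psCount, Nat.card_eq_fintype_card, Fintype.card_subtype]
  symm
  refine Finset.card_bij (fun x _ => (x.1, fun v => I.orderEmbOfFin rfl (x.2 v))) ?_ ?_ ?_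
  · rintro ⟨μ, φ⟩ h
    simp only [Finset.mem_filter, Finset.mem_univ, true_and, TT, TP] at h ⊢
    obtain ⟨h1, h2, h3, h4, h5⟩ := h
    refine ⟨⟨h1, h2, h3, fun v => by rw [h5]⟩, ?_⟩
    apply Finset.coe_injective
    rw [Finset.coe_image, Finset.coe_univ, Set.image_univ]
    change Set.range (I.orderEmbOfFin rfl ∘ φ) = I
    rw [h4.range_comp, Finset.range_orderEmbOfFin]
  · rintro ⟨μ, φ⟩ _ ⟨μ', φ'⟩ _ h
    simp only [Prod.mk.injEq] at h ⊢
    refine ⟨h.1, funext fun v => ?_⟩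
    exact (I.orderEmbOfFin rfl).injective (congrFun h.2 v)
  · rintro ⟨μ, φ⟩ h
    simp only [Finset.mem_filter, Finset.mem_univ, true_and, TT, TP] at h
    obtain ⟨⟨h1, h2, h3, h4⟩, h5⟩ := h
    have hm : ∀ v, ∃ k, I.orderEmbOfFin rfl k = φ v := by
      intro v
      have : φ v ∈ Set.range (I.orderEmbOfFin rfl) := by
        rw [Finset.range_orderEmbOfFin, ← h5]; simp
      exact this
    choose ψ hψ using hm
    refine ⟨(μ, ψ), ?_, by simp [hψ]⟩
    simp only [Finset.mem_filter, Finset.mem_univ, true_and]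
    refine ⟨h1, h2, h3, ?_, fun v => (I.orderEmbOfFin rfl).injective (by rw [hψ, hψ, h4])⟩
    intro k
    have : I.orderEmbOfFin rfl k ∈ Finset.univ.image φ := by rw [h5]; simp
    simp only [Finset.mem_image, Finset.mem_univ, true_and] at this
    obtain ⟨v, hv⟩ := this
    exact ⟨v, (I.orderEmbOfFin rfl).injective (by rw [hψ, hv])⟩

theorem ff_psCount (p q s N : ℕ) (hp : 1 ≤ p) (hq : 1 ≤ q) (hs : 1 ≤ s) :
    ff N p q s = ∑ k ∈ Finset.range (N+1), (N.choose k : ℚ) * psCount p q s k := by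
  classical
  rw [← card_TT p q s hp hq hs]
  rw [Finset.card_eq_sum_card_fiberwise (f := fun x => Finset.univ.image x.2)
    (t := (Finset.univ : Finset (Fin N)).powerset) (by simp)]
  rw [Finset.sum_congr rfl fun I _ => card_fiber2 p q s I]
  rw [Finset.sum_powerset_apply_card (fun k => psCount p q s k)]
  simp

lemma psCount_zero (p q s : ℕ) (hp : 1 ≤ p) : psCount p q s 0 = 0 := by
  rw [psCount]
  have : IsEmpty ((Fin p ⊕ Fin q) → Fin 0) := ⟨fun f => (f (Sum.inl ⟨0, hp⟩)).elim0⟩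
  simp

end Cnt
end PS

namespace PS
set_option linter.unusedSectionVars false
set_option linter.unusedSimpArgs false

section Num

noncomputable def gg (j a b i : ℕ) : ℚ :=
  if i ≤ a ∧ i ≤ b then (j.choose (b-i) : ℚ) / (2^i * i.factorial * (a-i).factorial) else 0

lemma gg_i1 (j a b i : ℕ) : ((a:ℚ)+1-i) * gg j (a+1) b i = gg j a b i := by
  unfold gg
  by_cases hb : i ≤ b
  · by_cases ha : i ≤ a
    · rw [if_pos ⟨by omega, hb⟩, if_pos ⟨ha, hb⟩]
      obtain ⟨d, rfl⟩ := Nat.exists_eq_add_of_le ha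
      have h1 : i + d + 1 - i = d + 1 := by omega
      have h2 : i + d - i = d := by omega
      rw [h1, h2, Nat.factorial_succ]
      have := d.factorial_ne_zero
      have := i.factorial_ne_zero
      push_cast
      have h3 : (d:ℚ)+1 ≠ 0 := by positivity
      field_simp
      ring
    · rw [if_neg (by omega : ¬ (i ≤ a ∧ i ≤ b))]
      split_ifs with h
      · have : i = a + 1 := by omega
        subst this; simp
      · simp
  · rw [if_neg (by tauto), if_neg (by tauto)]; simp

lemma gg_i1z (j b i : ℕ) : (((0:ℕ):ℚ)-i) * gg j 0 b i = 0 := by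
  unfold gg
  split_ifs with h
  · have : i = 0 := by omega
    subst this; simp
  · simp

lemma gg_i2 (j a b i : ℕ) : ((j:ℚ)-b+i) * gg j a b i = (b+1-i) * gg j a (b+1) i := by
  unfold gg
  by_cases ha : i ≤ a
  · by_cases hb : i ≤ b
    · rw [if_pos ⟨ha, hb⟩, if_pos ⟨ha, by omega⟩]
      obtain ⟨d, rfl⟩ := Nat.exists_eq_add_of_le hb
      have h1 : i + d + 1 - i = d + 1 := by omega
      have h2 : i + d - i = d := by omega
      rw [h1, h2]
      have key : (j.choose (d+1) : ℚ) * (d+1) = j.choose d * (j - d) := by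
        by_cases hd : d ≤ j
        · have := Nat.choose_succ_right_eq j d
          rw [← Nat.cast_sub hd]
          exact_mod_cast this
        · rw [Nat.choose_eq_zero_of_lt (by omega : j < d), Nat.choose_eq_zero_of_lt (by omega : j < d+1)]
          simp
      have e1 : (((i+d : ℕ):ℚ) + 1 - i) = d + 1 := by push_cast; ring
      have e2 : ((j:ℚ) - ((i+d : ℕ):ℚ) + i) = j - d := by push_cast; ring
      rw [e1, e2, ← mul_div_assoc, ← mul_div_assoc, mul_comm _ (j.choose d : ℚ), ← key, mul_comm]
    · rw [if_neg (by tauto)]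
      split_ifs with h
      · have : i = b + 1 := by omega
        subst this; simp
      · simp
  · rw [if_neg (by tauto), if_neg (by tauto)]; simp

lemma gg_i3 (j a b i : ℕ) : ((a:ℚ)-i) * gg j a b i = 2*(i+1) * gg j a (b+1) (i+1) := by
  unfold gg
  by_cases hb : i ≤ b
  · by_cases ha : i + 1 ≤ a
    · rw [if_pos ⟨by omega, hb⟩, if_pos ⟨ha, by omega⟩]
      obtain ⟨d, rfl⟩ := Nat.exists_eq_add_of_le ha
      have h1 : i + 1 + d - i = d + 1 := by omega
      have h2 : i + 1 + d - (i + 1) = d := by omega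
      have h4 : b + 1 - (i + 1) = b - i := by omega
      rw [h1, h2, h4, Nat.factorial_succ, Nat.factorial_succ]
      have := d.factorial_ne_zero
      have := i.factorial_ne_zero
      push_cast
      have h3 : (d:ℚ)+1 ≠ 0 := by positivity
      have h5 : (i:ℚ)+1 ≠ 0 := by positivity
      field_simp
      ring
    · rw [if_neg (by omega : ¬ (i + 1 ≤ a ∧ _))]
      split_ifs with h
      · have : i = a := by omega
        subst this; simp
      · simp
  · rw [if_neg (by tauto), if_neg (by omega)]; simp

noncomputable def SS (K j a b : ℕ) : ℚ := ∑ i ∈ Finset.range K, gg j a b i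

lemma SS_I (K j a b : ℕ) (hK : b + 1 < K) : ((a:ℚ)+b+1) * SS K j a (b+1) =
    ∑ i ∈ Finset.range K, ((a:ℚ)-i) * gg j a (b+1) i + (j+a-b) * SS K j a b := by
  have h : ∑ i ∈ Finset.range K, 2*((i:ℚ)+1) * gg j a (b+1) (i+1)
      = ∑ i ∈ Finset.range K, 2*(i:ℚ) * gg j a (b+1) i := by
    have h1 := Finset.sum_range_succ (fun i : ℕ => 2*(i:ℚ) * gg j a (b+1) i) K
    have h2 := Finset.sum_range_succ' (fun i : ℕ => 2*(i:ℚ) * gg j a (b+1) i) K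
    have h3 : gg j a (b+1) K = 0 := by rw [gg, if_neg (by omega)]
    rw [h3] at h1
    rw [h1] at h2
    push_cast at h2
    linarith
  have h4 : (j+a-b) * SS K j a b = ∑ i ∈ Finset.range K, ((b:ℚ)+1-i) * gg j a (b+1) i
      + ∑ i ∈ Finset.range K, 2*(i:ℚ) * gg j a (b+1) i := by
    rw [← h, SS, Finset.mul_sum, ← Finset.sum_add_distrib]
    refine Finset.sum_congr rfl fun i _ => ?_
    rw [← gg_i2, ← gg_i3]; ring
  rw [h4, SS, Finset.mul_sum, ← Finset.sum_add_distrib, ← Finset.sum_add_distrib]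
  refine Finset.sum_congr rfl fun i _ => ?_
  ring

lemma SS_II (K j a b : ℕ) : ∑ i ∈ Finset.range K, (((a+1:ℕ):ℚ)-i) * gg j (a+1) b i = SS K j a b := by
  rw [SS]
  refine Finset.sum_congr rfl fun i _ => ?_
  push_cast; exact gg_i1 ..

lemma SS_IIz (K j b : ℕ) : ∑ i ∈ Finset.range K, (((0:ℕ):ℚ)-i) * gg j 0 b i = 0 :=
  Finset.sum_eq_zero fun _ _ => gg_i1z ..

lemma SS_III (K j a : ℕ) : ∑ i ∈ Finset.range K, ((a:ℚ)-i) * gg j a 0 i = a * SS K j a 0 := by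
  rw [SS, Finset.mul_sum]
  refine Finset.sum_congr rfl fun i _ => ?_
  rcases i with _ | i
  · simp
  · rw [gg, if_neg (by omega)]; simp

lemma tt_closed (K j q : ℕ) : ∀ a b l : ℕ, a + b = q → j + a = l + b → q < K →
    tt q j l = q.factorial * SS K j a b := by
  induction q with
  | zero =>
    intro a b l h1 h2 h3
    obtain ⟨rfl, rfl⟩ : a = 0 ∧ b = 0 := by omega
    obtain rfl : j = l := by omega
    rw [SS, Finset.sum_eq_single 0]
    · simp [tt, gg]
    · intro i _ hi; rw [gg, if_neg (by omega)]
    · intro h; simp at h; omega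
  | succ q ih =>
    intro a b l h1 h2 h3
    have hq : (((q+1).factorial : ℕ) : ℚ) = (q.factorial : ℚ) * (a + b) := by
      rw [Nat.factorial_succ, ← h1]; push_cast; ring
    rcases l with _ | l
    · rcases b with _ | b
      · omega
      have e := SS_I K j a b (by omega)
      have z : ∑ i ∈ Finset.range K, ((a:ℚ)-i) * gg j a (b+1) i = 0 := by
        refine Finset.sum_eq_zero fun i _ => ?_
        rw [gg]
        split_ifs with h
        · by_cases hi : i = a
          · subst hi; simp
          · rw [Nat.choose_eq_zero_of_lt (by omega)]; simp
        · simp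
      have hb : (j:ℚ) + a = b + 1 := by exact_mod_cast (by omega : j + a = b + 1)
      rw [z, hb] at e
      have : tt (q+1) j 0 = tt q j 1 := by simp [tt]
      rw [this, ih a b 1 (by omega) (by omega) (by omega), hq]
      push_cast
      linear_combination (-(q.factorial : ℚ)) * e
    · have : tt (q+1) j (l+1) = tt q j l + (l+2) * tt q j (l+2) := by simp [tt]
      rw [this, hq]
      have hl : (j:ℚ) + a = l + 1 + b := by exact_mod_cast h2
      rcases b with _ | b
      · rw [tt_big q j (l+2) (by omega)]
        rcases a with _ | a
        · omega
        rw [ih a 0 l (by omega) (by omega) (by omega), ← SS_II, SS_III]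
        push_cast; ring
      · have e := SS_I K j a b (by omega)
        rw [ih a b (l+2) (by omega) (by omega) (by omega)]
        rcases a with _ | a
        · rw [tt_small q j l (by omega)]
          rw [SS_IIz] at e
          push_cast at hl e ⊢
          linear_combination (-(q.factorial : ℚ)) * e - (q.factorial : ℚ) * SS K j 0 b * hl
        · rw [ih a (b+1) l (by omega) (by omega) (by omega)]
          rw [SS_II] at e
          push_cast at hl e ⊢
          linear_combination (-(q.factorial : ℚ)) * e - (q.factorial : ℚ) * SS K j (a+1) b * hl

lemma SS_shrink (K K' j a b : ℕ) (h : K ≤ K') (hb : a < K ∨ b < K) : SS K' j a b = SS K j a b := by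
  rw [SS, SS]
  symm
  refine Finset.sum_subset (Finset.range_subset_range.2 h) fun i _ hi => ?_
  rw [Finset.mem_range] at hi
  rw [gg, if_neg (by omega)]

lemma conv (N m a b : ℕ) (ha : a ≤ m) (hb : b ≤ m) (hN : b ≤ N) :
    ∑ κ ∈ Finset.range (m+1), N.choose κ * m.choose κ * (κ.choose a * κ.choose b)
      = N.choose b * m.choose a * (N - b + (m - a)).choose (m - b) := by
  obtain ⟨d, rfl⟩ := Nat.exists_eq_add_of_le hb
  have hz : ∑ κ ∈ Finset.range b, N.choose κ * (b+d).choose κ * (κ.choose a * κ.choose b) = 0 := by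
    refine Finset.sum_eq_zero fun κ hκ => ?_
    rw [Finset.mem_range] at hκ
    rw [Nat.choose_eq_zero_of_lt hκ]; simp
  rw [show b + d + 1 = b + (d + 1) by ring, Finset.sum_range_add, hz, zero_add]
  · rw [show b + d - b = d by omega, Nat.add_choose_eq (N-b), Finset.Nat.sum_antidiagonal_eq_sum_range_succ_mk,
      Finset.mul_sum]
    refine Finset.sum_congr rfl fun t ht => ?_
    rw [Finset.mem_range] at ht
    have h1 : N.choose (b+t) * (b+t).choose b = N.choose b * (N-b).choose t := by
      by_cases hh : b + t ≤ N
      · rw [Nat.choose_mul (by omega)]; congr 2; omega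
      · rw [Nat.choose_eq_zero_of_lt (by omega : N < b + t), Nat.choose_eq_zero_of_lt (by omega : N - b < t)]
        simp
    have h2 : (b+d).choose (b+t) * (b+t).choose a = (b+d).choose a * (b+d-a).choose (d-t) := by
      by_cases hh : a ≤ b + t
      · rw [Nat.choose_mul (by omega), ← Nat.choose_symm (by omega : b + t - a ≤ b + d - a)]
        congr 2; omega
      · rw [Nat.choose_eq_zero_of_lt (by omega : b + t < a), Nat.choose_eq_zero_of_lt (by omega : b+d-a < d - t)]
        simp
    calc _ = (N.choose (b+t) * (b+t).choose b) * ((b+d).choose (b+t) * (b+t).choose a) := by ring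
      _ = _ := by rw [h1, h2]; ring

def f1 (u v s l : ℕ) : ℚ := ((l+s).choose (u+s) : ℚ) * l.choose v

lemma RHS_eq (N u v s : ℕ) : ∑ l ∈ Finset.range N, (if N ≤ l + s then f1 u v s l else 0)
    = ∑ l ∈ Finset.range N, f1 u v s l - ∑ l ∈ Finset.range (N-s), f1 u v s l := by
  rw [eq_sub_iff_add_eq]
  have : ∑ l ∈ Finset.range (N-s), f1 u v s l = ∑ l ∈ Finset.range N, (if N ≤ l + s then 0 else f1 u v s l) := by
    rw [← Finset.sum_subset (Finset.range_subset_range.2 (Nat.sub_le N s))]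
    · refine Finset.sum_congr rfl fun l hl => ?_
      rw [Finset.mem_range] at hl
      rw [if_neg (by omega)]
    · intro l _ hl
      rw [Finset.mem_range] at hl
      rw [if_pos (by omega)]
  rw [this, ← Finset.sum_add_distrib]
  refine Finset.sum_congr rfl fun l _ => ?_
  split_ifs <;> simp

lemma telescope (N u v s : ℕ) :
    ∑ κ ∈ Finset.range (u+v+s+1), (N.choose (κ+1) : ℚ) * (u+v+s).choose κ *
      ((κ.choose u : ℚ) * κ.choose v - κ.choose (u+s) * κ.choose (v+s))
      = (u+v+s).choose u * ∑ l ∈ Finset.range N, (if N ≤ l + s then f1 u v s l else 0) := by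
  rw [RHS_eq]
  induction N with
  | zero => simp
  | succ N ih =>
    have h1 : ∑ κ ∈ Finset.range (u+v+s+1), (N.choose κ : ℚ) * (u+v+s).choose κ *
        ((κ.choose u : ℚ) * κ.choose v) = (u+v+s).choose u * f1 u v s N := by
      by_cases hv : v ≤ N
      · have := conv N (u+v+s) u v (by omega) (by omega) hv
        rw [show N - v + (u+v+s-u) = N + s by omega, show u+v+s-v = u+s by omega] at this
        rw [f1]
        have h2 := congrArg (Nat.cast : ℕ → ℚ) this
        push_cast at h2
        rw [h2]; ring
      · rw [f1, Nat.choose_eq_zero_of_lt (by omega : N < v)]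
        rw [Finset.sum_eq_zero]
        · simp
        · intro κ _
          by_cases hk : κ < v
          · rw [Nat.choose_eq_zero_of_lt hk]; simp
          · rw [Nat.choose_eq_zero_of_lt (by omega : N < κ)]; simp
    have h2 : ∑ κ ∈ Finset.range (u+v+s+1), (N.choose κ : ℚ) * (u+v+s).choose κ *
        ((κ.choose (u+s) : ℚ) * κ.choose (v+s)) = (u+v+s).choose u * (if s ≤ N then f1 u v s (N-s) else 0) := by
      by_cases hv : u + s ≤ N
      · have := conv N (u+v+s) (v+s) (u+s) (by omega) (by omega) hv
        rw [show N - (u+s) + (u+v+s-(v+s)) = N - s by omega, show u+v+s-(u+s) = v by omega,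
          ← Nat.choose_symm (by omega : v + s ≤ u+v+s), show u+v+s-(v+s) = u by omega] at this
        rw [if_pos (by omega), f1, show N - s + s = N by omega]
        have h2 := congrArg (Nat.cast : ℕ → ℚ) this
        push_cast at h2
        rw [show (((u+v+s).choose u : ℕ):ℚ) * (N.choose (u+s) * (N-s).choose v) = N.choose (u+s) * (u+v+s).choose u * (N-s).choose v by ring, ← h2]
        refine Finset.sum_congr rfl fun κ _ => ?_
        ring
      · have : (if s ≤ N then f1 u v s (N-s) else 0) = 0 := by
          split_ifs with h
          · rw [f1, show N - s + s = N by omega, Nat.choose_eq_zero_of_lt (by omega : N < u + s)]; simp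
          · rfl
        rw [this, mul_zero, Finset.sum_eq_zero]
        intro κ _
        by_cases hk : κ < u + s
        · rw [Nat.choose_eq_zero_of_lt hk]; simp
        · rw [Nat.choose_eq_zero_of_lt (by omega : N < κ)]; simp
    have h3 : ∑ l ∈ Finset.range (N+1-s), f1 u v s l
        = ∑ l ∈ Finset.range (N-s), f1 u v s l + (if s ≤ N then f1 u v s (N-s) else 0) := by
      split_ifs with h
      · rw [show N + 1 - s = N - s + 1 by omega, Finset.sum_range_succ]
      · rw [show N + 1 - s = N - s by omega, add_zero]
    rw [Finset.sum_range_succ (f1 u v s), h3]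
    have h4 : ∀ κ ∈ Finset.range (u+v+s+1), ((N+1).choose (κ+1) : ℚ) * (u+v+s).choose κ *
      ((κ.choose u : ℚ) * κ.choose v - κ.choose (u+s) * κ.choose (v+s)) =
      (N.choose (κ+1) : ℚ) * (u+v+s).choose κ *
      ((κ.choose u : ℚ) * κ.choose v - κ.choose (u+s) * κ.choose (v+s)) +
      ((N.choose κ : ℚ) * (u+v+s).choose κ * ((κ.choose u : ℚ) * κ.choose v)
      - (N.choose κ : ℚ) * (u+v+s).choose κ * ((κ.choose (u+s) : ℚ) * κ.choose (v+s))) := by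
      intro κ _
      rw [Nat.choose_succ_succ]; push_cast; ring
    rw [Finset.sum_congr rfl h4, Finset.sum_add_distrib, Finset.sum_sub_distrib, ih, h1, h2]
    ring

end Num
end PS

namespace PS
set_option linter.unusedSectionVars false
set_option linter.unusedSimpArgs false

section Fin

noncomputable def BB (p q s n k : ℕ) : ℚ :=
      (p.factorial : ℚ) * (q.factorial : ℚ) *
        ∑ i ∈ Finset.range (p / 2 + 1), ∑ j ∈ Finset.range (q / 2 + 1),
          (((n - i - j).choose (k - 1) : ℚ) /
              (2 ^ (i + j) * (Nat.factorial i : ℚ) * (Nat.factorial j : ℚ) *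
                (Nat.factorial (n - i - j) : ℚ))) *
            ((ichoose ((k : ℤ) - 1) (((p : ℤ) - s) / 2 - i) *
                ichoose ((k : ℤ) - 1) (((q : ℤ) - s) / 2 - j) -
              ichoose ((k : ℤ) - 1) (((p : ℤ) + s) / 2 - i) *
                ichoose ((k : ℤ) - 1) (((q : ℤ) + s) / 2 - j) : ℤ) : ℚ)

lemma ichoose_nat (κ x : ℕ) : ichoose κ x = (κ.choose x : ℕ) := by
  rw [ichoose]
  split_ifs with h
  · simp
  · rw [Nat.choose_eq_zero_of_lt (by omega)]; rfl

lemma ichoose_neg (a b : ℤ) (h : b < 0) : ichoose a b = 0 := by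
  rw [ichoose, if_neg (by omega)]
lemma ichoose_gt (a b : ℤ) (h : a < b) : ichoose a b = 0 := by
  rw [ichoose, if_neg (by omega)]

/-- one term -/
noncomputable def tm (p q s n κ i j : ℕ) : ℚ :=
          (((n - i - j).choose κ : ℚ) /
              (2 ^ (i + j) * (Nat.factorial i : ℚ) * (Nat.factorial j : ℚ) *
                (Nat.factorial (n - i - j) : ℚ))) *
            ((ichoose κ (((p : ℤ) - s) / 2 - i) *
                ichoose κ (((q : ℤ) - s) / 2 - j) -
              ichoose κ (((p : ℤ) + s) / 2 - i) *
                ichoose κ (((q : ℤ) + s) / 2 - j) : ℤ) : ℚ)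

lemma BB_succ (p q s n κ : ℕ) : BB p q s n (κ+1) = (p.factorial : ℚ) * (q.factorial : ℚ) *
    ∑ i ∈ Finset.range (p / 2 + 1), ∑ j ∈ Finset.range (q / 2 + 1), tm p q s n κ i j := by
  have : ((κ+1 : ℕ) : ℤ) - 1 = κ := by push_cast; ring
  simp only [BB, tm, this, Nat.add_sub_cancel]

lemma tm_zero (p q s n κ i j : ℕ) (hps : p % 2 = s % 2) (hqs : q % 2 = s % 2) (hn : p + q = 2 * n)
    (hi : i ≤ p / 2) (hj : j ≤ q / 2)
    (h : ((p : ℤ) - s) / 2 - i < 0 ∨ ((q : ℤ) - s) / 2 - j < 0) : tm p q s n κ i j = 0 := by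
  rw [tm]
  by_cases hκ : n - i - j < κ
  · rw [Nat.choose_eq_zero_of_lt hκ]; simp
  · have h1 : ichoose κ (((p : ℤ) - s) / 2 - i) * ichoose κ (((q : ℤ) - s) / 2 - j) = 0 := by
      rcases h with h | h
      · rw [ichoose_neg _ _ h, zero_mul]
      · rw [ichoose_neg _ _ h, mul_zero]
    have h2 : ichoose κ (((p : ℤ) + s) / 2 - i) * ichoose κ (((q : ℤ) + s) / 2 - j) = 0 := by
      rcases h with h | h
      · rw [ichoose_gt _ (((q : ℤ) + s) / 2 - j) (by omega), mul_zero]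
      · rw [ichoose_gt _ (((p : ℤ) + s) / 2 - i) (by omega), zero_mul]
    rw [h1, h2]; simp

lemma tm_sum (u0 v0 s N i j : ℕ) (hi : i ≤ (2*u0+s) / 2) (hj : j ≤ (2*v0+s) / 2) :
    ∑ κ ∈ Finset.range N, (N.choose (κ+1) : ℚ) * tm (2*u0+s) (2*v0+s) s (u0+v0+s) κ i j
      = ∑ l ∈ Finset.range N, if N ≤ l + s then gg (l+s) u0 (u0+s) i * gg l (v0+s) v0 j else 0 := by
  by_cases h : i ≤ u0 ∧ j ≤ v0
  swap
  · rw [Finset.sum_eq_zero, Finset.sum_eq_zero]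
    · intro l _
      split_ifs
      · rw [not_and_or] at h
        rcases h with h | h
        · rw [gg, if_neg (by omega), zero_mul]
        · rw [gg, gg, if_neg (by omega : ¬ (j ≤ v0 + s ∧ j ≤ v0)), mul_zero]
      · rfl
    · intro κ _
      rw [tm_zero _ _ _ _ _ _ _ (by omega) (by omega) (by omega) hi hj (by omega), mul_zero]
  obtain ⟨h1, h2⟩ := h
  obtain ⟨u, rfl⟩ := Nat.exists_eq_add_of_le h1
  obtain ⟨v, rfl⟩ := Nat.exists_eq_add_of_le h2
  have ht : ∀ κ, tm (2*(i+u)+s) (2*(j+v)+s) s (i+u+(j+v)+s) κ i j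
      = ((u+v+s).choose κ : ℚ) / (2 ^ (i + j) * (Nat.factorial i : ℚ) * (Nat.factorial j : ℚ) *
                (Nat.factorial (u+v+s) : ℚ)) *
        ((κ.choose u : ℚ) * κ.choose v - κ.choose (u+s) * κ.choose (v+s)) := by
    intro κ
    rw [tm, show i+u+(j+v)+s - i - j = u+v+s by omega,
      show (((2*(i+u)+s : ℕ) : ℤ) - s) / 2 - i = (u : ℕ) by push_cast; omega,
      show (((2*(j+v)+s : ℕ) : ℤ) - s) / 2 - j = (v : ℕ) by push_cast; omega,
      show (((2*(i+u)+s : ℕ) : ℤ) + s) / 2 - i = (u + s : ℕ) by push_cast; omega,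
      show (((2*(j+v)+s : ℕ) : ℤ) + s) / 2 - j = (v + s : ℕ) by push_cast; omega]
    simp only [ichoose_nat]
    push_cast
    rfl
  have hg : ∀ l, gg (l+s) (i+u) (i+u+s) i * gg l (j+v+s) (j+v) j
      = f1 u v s l / (2^i * i.factorial * u.factorial * (2^j * j.factorial * (v+s).factorial)) := by
    intro l
    rw [gg, gg, if_pos (by omega), if_pos (by omega), f1, show i + u + s - i = u + s by omega,
      show i + u - i = u by omega, show j + v - j = v by omega, show j+v+s-j = v+s by omega]
    rw [div_mul_div_comm]
  have e1 : ∑ κ ∈ Finset.range N, (N.choose (κ+1) : ℚ) * tm (2*(i+u)+s) (2*(j+v)+s) s (i+u+(j+v)+s) κ i j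
      = ∑ κ ∈ Finset.range (N + (u+v+s+1)), (N.choose (κ+1) : ℚ) * tm (2*(i+u)+s) (2*(j+v)+s) s (i+u+(j+v)+s) κ i j := by
    refine Finset.sum_subset (Finset.range_subset_range.2 (by omega)) fun κ _ hκ => ?_
    rw [Finset.mem_range] at hκ
    rw [Nat.choose_eq_zero_of_lt (by omega)]; simp
  have e2 : ∑ κ ∈ Finset.range (u+v+s+1), (N.choose (κ+1) : ℚ) * tm (2*(i+u)+s) (2*(j+v)+s) s (i+u+(j+v)+s) κ i j
      = ∑ κ ∈ Finset.range (N + (u+v+s+1)), (N.choose (κ+1) : ℚ) * tm (2*(i+u)+s) (2*(j+v)+s) s (i+u+(j+v)+s) κ i j := by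
    refine Finset.sum_subset (Finset.range_subset_range.2 (by omega)) fun κ _ hκ => ?_
    rw [Finset.mem_range] at hκ
    rw [ht, Nat.choose_eq_zero_of_lt (by omega : u+v+s < κ)]; simp
  rw [e1, ← e2]
  have ch : ((u+v+s).choose u : ℚ) = (u+v+s).factorial / (u.factorial * (v+s).factorial) := by
    rw [Nat.cast_choose ℚ (by omega), show u+v+s-u = v+s by omega]
  have T := telescope N u v s
  rw [ch] at T
  have hr : ∑ l ∈ Finset.range N, (if N ≤ l + s then gg (l+s) (i+u) (i+u+s) i * gg l (j+v+s) (j+v) j else 0)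
     = (∑ l ∈ Finset.range N, (if N ≤ l + s then f1 u v s l else 0)) / (2^i * i.factorial * u.factorial * (2^j * j.factorial * (v+s).factorial)) := by
    rw [Finset.sum_div]
    refine Finset.sum_congr rfl fun l _ => ?_
    rw [hg]; split_ifs <;> simp
  have hl : ∑ κ ∈ Finset.range (u+v+s+1), (N.choose (κ+1) : ℚ) * tm (2*(i+u)+s) (2*(j+v)+s) s (i+u+(j+v)+s) κ i j
     = (∑ κ ∈ Finset.range (u+v+s+1), (N.choose (κ+1) : ℚ) * (u+v+s).choose κ *
      ((κ.choose u : ℚ) * κ.choose v - κ.choose (u+s) * κ.choose (v+s))) / (2 ^ (i + j) * (Nat.factorial i : ℚ) * (Nat.factorial j : ℚ) *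
                (Nat.factorial (u+v+s) : ℚ)) := by
    rw [Finset.sum_div]
    refine Finset.sum_congr rfl fun κ _ => ?_
    rw [ht]; ring
  rw [hr, hl, T]
  have := (u+v+s).factorial_ne_zero
  have := (v+s).factorial_ne_zero
  have := u.factorial_ne_zero
  have := i.factorial_ne_zero
  have := j.factorial_ne_zero
  rw [pow_add]
  field_simp

lemma ff_BB (p q s n N : ℕ) (hps : p % 2 = s % 2) (hqs : q % 2 = s % 2) (hn : p + q = 2 * n) :
    ff N p q s = ∑ κ ∈ Finset.range N, (N.choose (κ+1) : ℚ) * BB p q s n (κ+1) := by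
  have hB : ∑ κ ∈ Finset.range N, (N.choose (κ+1) : ℚ) * BB p q s n (κ+1)
      = (p.factorial : ℚ) * (q.factorial : ℚ) *
        ∑ i ∈ Finset.range (p / 2 + 1), ∑ j ∈ Finset.range (q / 2 + 1),
          ∑ κ ∈ Finset.range N, (N.choose (κ+1) : ℚ) * tm p q s n κ i j := by
    have : ∀ i, ∑ j ∈ Finset.range (q / 2 + 1), ∑ κ ∈ Finset.range N, (N.choose (κ+1) : ℚ) * tm p q s n κ i j
      = ∑ κ ∈ Finset.range N, ∑ j ∈ Finset.range (q / 2 + 1), (N.choose (κ+1) : ℚ) * tm p q s n κ i j :=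
      fun i => Finset.sum_comm
    rw [Finset.sum_congr rfl fun i _ => this i, Finset.sum_comm, Finset.mul_sum]
    refine Finset.sum_congr rfl fun κ _ => ?_
    rw [BB_succ]
    simp only [← Finset.mul_sum]
    ring
  rw [hB]
  by_cases h : s ≤ p ∧ s ≤ q
  · obtain ⟨u0, rfl⟩ : ∃ u0, p = 2*u0+s := ⟨(p-s)/2, by omega⟩
    obtain ⟨v0, rfl⟩ : ∃ v0, q = 2*v0+s := ⟨(q-s)/2, by omega⟩
    obtain rfl : n = u0+v0+s := by omega
    have e : ∀ l, tt (2*v0+s) l (l+s) * tt (2*u0+s) (l+s) l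
        = ((2*u0+s).factorial : ℚ) * ((2*v0+s).factorial : ℚ) *
        ∑ i ∈ Finset.range ((2*u0+s) / 2 + 1), ∑ j ∈ Finset.range ((2*v0+s) / 2 + 1),
          gg (l+s) u0 (u0+s) i * gg l (v0+s) v0 j := by
      intro l
      rw [tt_closed (2*v0+s+1) l (2*v0+s) (v0+s) v0 (l+s) (by omega) (by omega) (by omega),
        tt_closed (2*u0+s+1) (l+s) (2*u0+s) u0 (u0+s) l (by omega) (by omega) (by omega),
        SS_shrink ((2*v0+s)/2+1) (2*v0+s+1) l (v0+s) v0 (by omega) (by omega),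
        SS_shrink ((2*u0+s)/2+1) (2*u0+s+1) (l+s) u0 (u0+s) (by omega) (by omega), ← Finset.sum_mul_sum, SS, SS]
      ring
    have e2 : ∀ i ∈ Finset.range ((2*u0+s) / 2 + 1), ∀ j ∈ Finset.range ((2*v0+s) / 2 + 1),
       ∑ κ ∈ Finset.range N, (N.choose (κ+1) : ℚ) * tm (2*u0+s) (2*v0+s) s (u0+v0+s) κ i j
      = ∑ l ∈ Finset.range N, if N ≤ l + s then gg (l+s) u0 (u0+s) i * gg l (v0+s) v0 j else 0 := by
      intro i hi j hj
      rw [Finset.mem_range] at hi hj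
      exact tm_sum u0 v0 s N i j (by omega) (by omega)
    rw [Finset.sum_congr rfl fun i hi => Finset.sum_congr rfl fun j hj => e2 i hi j hj]
    have e3 : ∀ i, ∑ j ∈ Finset.range ((2*v0+s) / 2 + 1), ∑ l ∈ Finset.range N, (if N ≤ l + s then gg (l+s) u0 (u0+s) i * gg l (v0+s) v0 j else 0)
      = ∑ l ∈ Finset.range N, ∑ j ∈ Finset.range ((2*v0+s) / 2 + 1), (if N ≤ l + s then gg (l+s) u0 (u0+s) i * gg l (v0+s) v0 j else 0) :=
      fun i => Finset.sum_comm
    rw [Finset.sum_congr rfl fun i _ => e3 i, Finset.sum_comm, Finset.mul_sum, ff,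
      Fin.sum_univ_eq_sum_range (fun l => if N ≤ l + s then tt (2*v0+s) l (l+s) * tt (2*u0+s) (l+s) l else 0)]
    refine Finset.sum_congr rfl fun l _ => ?_
    split_ifs with hl
    · exact e l
    · simp
  · have hf : ff N p q s = 0 := by
      rw [ff]
      refine Finset.sum_eq_zero fun l _ => ?_
      split_ifs
      · rw [not_and_or] at h
        rcases h with h | h
        · rw [tt_small p _ _ (by omega), mul_zero]
        · rw [tt_big q _ _ (by omega), zero_mul]
      · rfl
    rw [hf, Finset.sum_eq_zero, mul_zero]
    intro i hi
    refine Finset.sum_eq_zero fun j hj => Finset.sum_eq_zero fun κ _ => ?_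
    rw [Finset.mem_range] at hi hj
    rw [tm_zero p q s n κ i j hps hqs hn (by omega) (by omega) (by omega), mul_zero]

theorem main_eq (p q s n : ℕ) (hp : 1 ≤ p) (hq : 1 ≤ q) (hs : 1 ≤ s)
    (hps : p % 2 = s % 2) (hqs : q % 2 = s % 2) (hn : p + q = 2 * n) (κ : ℕ) :
    (psCount p q s (κ+1) : ℚ) = BB p q s n (κ+1) := by
  induction κ using Nat.strong_induction_on with
  | _ κ ih =>
    have h := ff_psCount p q s (κ+1) hp hq hs
    rw [ff_BB p q s n (κ+1) hps hqs hn, Finset.sum_range_succ' _ (κ+1), psCount_zero p q s hp,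
      Finset.sum_range_succ, Finset.sum_range_succ] at h
    have h2 : ∑ x ∈ Finset.range κ, ((κ+1).choose (x+1) : ℚ) * psCount p q s (x+1)
        = ∑ x ∈ Finset.range κ, ((κ+1).choose (x+1) : ℚ) * BB p q s n (x+1) :=
      Finset.sum_congr rfl fun k hk => by rw [ih k (Finset.mem_range.1 hk)]
    rw [h2] at h
    simp at h
    exact h.symm

end Fin
end PS

theorem paired_surjection_count (p q s k n : ℕ) (hp : 1 ≤ p) (hq : 1 ≤ q) (hs : 1 ≤ s)
    (hk : 1 ≤ k) (hps : p % 2 = s % 2) (hqs : q % 2 = s % 2) (hn : p + q = 2 * n) :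
    (psCount p q s k : ℚ) =
      (p.factorial : ℚ) * (q.factorial : ℚ) *
        ∑ i ∈ Finset.range (p / 2 + 1), ∑ j ∈ Finset.range (q / 2 + 1),
          (((n - i - j).choose (k - 1) : ℚ) /
              (2 ^ (i + j) * (Nat.factorial i : ℚ) * (Nat.factorial j : ℚ) *
                (Nat.factorial (n - i - j) : ℚ))) *
            ((ichoose ((k : ℤ) - 1) (((p : ℤ) - s) / 2 - i) *
                ichoose ((k : ℤ) - 1) (((q : ℤ) - s) / 2 - j) -
              ichoose ((k : ℤ) - 1) (((p : ℤ) + s) / 2 - i) *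
                ichoose ((k : ℤ) - 1) (((q : ℤ) + s) / 2 - j) : ℤ) : ℚ) := by
  obtain ⟨κ, rfl⟩ := Nat.exists_eq_add_of_le' hk
  exact PS.main_eq p q s n hp hq hs hps hqs hn κ
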